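/- arXiv:2106.15443 — 9 statements merged into one kernel-verified Lean document; each statement's English description precedes it below -/
import Mathlib

section
/- Let M, m, s, z ∈ ℝ satisfy z < m < s < M, z = s − M − m, and s² = −M·m − (M+m)·z. Let L, ℓ > 0 and let ψ : ℝ → ℝ be continuous, even, periodic with period 2(L+ℓ), with ψ(x) = s for |x| ≤ ℓ, ψ infinitely differentiable on (ℓ, L+ℓ) with ψ'(x) < 0 there, ψ(L+ℓ) = m, and (s − ψ(x))·ψ'(x)² = (M − ψ(x))·(ψ(x) − m)·(ψ(x) − z) for all x ∈ (ℓ, L+ℓ). Set u(t,x) = ψ(x − s·t), u_x(t,x) = ψ'(x − s·t) (defined almost everywhere), and P(t,x) = s² − (1/2)·(s − ψ(x − s·t))². Then the energy conservation law fails weakly: there exists a test function Φ ∈ C_c^∞(ℝ × ℝ) such that ∬_{ℝ²} [ (u² + u_x²)·∂_tΦ + ( u·(u² + u_x²) − u³ + 2·P·u )·∂_xΦ ] dx dt ≠ 0. -/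
open MeasureTheory Set

/-- The square of the slope of a decreasing profile solving a cusp equation is integrable up to
the cusp: `ψ'²` is a continuous multiple of the derivative of `√(s - ψ)`. -/
theorem intervalIntegrable_sq_of_cusp {s a b : ℝ} (hab : a ≤ b) {ψ ψ' p : ℝ → ℝ}
    (hψ : Continuous ψ) (hp : Continuous p)
    (hderiv : ∀ x ∈ Ioo a b, HasDerivAt ψ (ψ' x) x)
    (hneg : ∀ x ∈ Ioo a b, ψ' x < 0)
    (hlt : ∀ x ∈ Ioo a b, ψ x < s)
    (hode : ∀ x ∈ Ioo a b, (s - ψ x) * ψ' x ^ 2 = p x) :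
    IntervalIntegrable (fun x => ψ' x ^ 2) volume a b := by
  have hroot : IntervalIntegrable (fun x => -ψ' x / (2 * √(s - ψ x))) volume a b := by
    refine intervalIntegral.intervalIntegrable_deriv_of_nonneg (g := fun x => √(s - ψ x))
      (by fun_prop) ?_ ?_ <;> rw [min_eq_left hab, max_eq_right hab] <;> intro x hx
    · exact ((hderiv x hx).const_sub s).sqrt (sub_pos.2 (hlt x hx)).ne'
    · exact div_nonneg (neg_nonneg.2 (hneg x hx).le) (by positivity)
  have hmul := hroot.mul_continuousOn (g := fun x => 2 * √(p x)) (by fun_prop)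
  refine hmul.congr_ae ?_
  rw [uIoc_of_le hab, ← restrict_Ioo_eq_restrict_Ioc]
  refine (ae_restrict_iff' measurableSet_Ioo).2 (.of_forall fun x hx => ?_)
  have hpos := Real.sqrt_pos.2 (sub_pos.2 (hlt x hx))
  simp only [← hode x hx]
  rw [Real.sqrt_mul (sub_pos.2 (hlt x hx)).le, Real.sqrt_sq_eq_abs, abs_of_neg (hneg x hx)]
  field_simp

/-- A product test function in the moving frame is a test function. -/
theorem hasCompactSupport_movingFrame {a b : ℝ → ℝ} (ha : HasCompactSupport a)
    (hb : HasCompactSupport b) (s : ℝ) :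
    HasCompactSupport fun p : ℝ × ℝ => a p.1 * b (p.2 - s * p.1) := by
  refine HasCompactSupport.intro
    ((ha.isCompact.prod hb.isCompact).image
      (f := fun q : ℝ × ℝ => (q.1, q.2 + s * q.1)) (by fun_prop)) fun p hp => ?_
  by_contra h
  refine hp ⟨(p.1, p.2 - s * p.1), ⟨subset_tsupport _ (left_ne_zero_of_mul h),
    subset_tsupport _ (right_ne_zero_of_mul h)⟩, ?_⟩
  ext <;> simp

/-- The weak form of `E_t + (G(ξ))_x`, with `E` and `G` travelling waves of speed `s`, tested
against a product in the moving frame: only the jump of the flux `G - s E` contributes. -/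
theorem integral_movingFrame {s : ℝ} {a b E G : ℝ → ℝ} (ha : ContDiff ℝ 1 a)
    (hb : ContDiff ℝ 1 b) (hac : HasCompactSupport a)
    (hE : Integrable fun ξ => E ξ * b ξ)
    (hG : Integrable fun ξ => (G ξ - s * E ξ) * deriv b ξ) :
    ∫ t : ℝ, ∫ x : ℝ, (E (x - s * t) * deriv (fun τ => a τ * b (x - s * τ)) t
        + G (x - s * t) * deriv (fun y => a t * b (y - s * t)) x)
      = (∫ t, a t) * ∫ ξ, (G ξ - s * E ξ) * deriv b ξ := by
  have had := ha.differentiable one_ne_zero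
  have hbd := hb.differentiable one_ne_zero
  have hinner (t : ℝ) : ∫ x : ℝ, (E (x - s * t) * deriv (fun τ => a τ * b (x - s * τ)) t
        + G (x - s * t) * deriv (fun y => a t * b (y - s * t)) x)
      = deriv a t * (∫ ξ, E ξ * b ξ) + a t * ∫ ξ, (G ξ - s * E ξ) * deriv b ξ := by
    rw [← integral_const_mul, ← integral_const_mul,
      ← integral_add (hE.const_mul _) (hG.const_mul _),
      ← integral_sub_right_eq_self (fun ξ => deriv a t * (E ξ * b ξ)
        + a t * ((G ξ - s * E ξ) * deriv b ξ)) (s * t)]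
    refine integral_congr_ae (.of_forall fun x => ?_)
    have hlin : HasDerivAt (fun τ => x - s * τ) (-s) t := by
      simpa using ((hasDerivAt_id t).const_mul s).const_sub x
    have ht := (had t).hasDerivAt.mul ((hbd (x - s * t)).hasDerivAt.comp t hlin)
    have hx := (((hbd (x - s * t)).hasDerivAt.comp x
      ((hasDerivAt_id x).sub_const (s * t)))).const_mul (a t)
    have ht' : deriv (fun τ => a τ * b (x - s * τ)) t
        = deriv a t * b (x - s * t) + a t * (deriv b (x - s * t) * -s) := ht.deriv
    have hx' : deriv (fun y => a t * b (y - s * t)) x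
        = a t * (deriv b (x - s * t) * 1) := hx.deriv
    simp only [ht', hx']
    ring
  have hai : Integrable a := ha.continuous.integrable_of_hasCompactSupport hac
  have hdi : Integrable (deriv a) :=
    (ha.continuous_deriv le_rfl).integrable_of_hasCompactSupport hac.deriv
  simp_rw [hinner]
  rw [integral_add (hdi.mul_const _) (hai.mul_const _), integral_mul_const, integral_mul_const,
    integral_eq_zero_of_hasDerivAt_of_integrable (fun t => (had t).hasDerivAt) hdi hai]
  ring

/-- The distributional derivative of a step function with a single jump at `d`. -/
theorem integral_step_mul_deriv {d c e α β : ℝ} (hcd : c ≤ d) (hde : d ≤ e) {F b : ℝ → ℝ}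
    (hb : ContDiff ℝ 1 b) (hsupp : tsupport b ⊆ Ioo c e)
    (hleft : ∀ x ∈ Ioo c d, F x = α) (hright : ∀ x ∈ Ioo d e, F x = β) :
    Integrable (fun x => F x * deriv b x) ∧ ∫ x, F x * deriv b x = (α - β) * b d := by
  have hbc := hb.continuous_deriv le_rfl
  have hbd := hb.differentiable one_ne_zero
  have hzero {x : ℝ} (hx : x ∉ Ioo c e) : b x = 0 :=
    image_eq_zero_of_notMem_tsupport fun h => hx (hsupp h)
  have hpiece {l r γ : ℝ} (hlr : l ≤ r) (hF : ∀ x ∈ Ioo l r, F x = γ) :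
      IntervalIntegrable (fun x => F x * deriv b x) volume l r ∧
        ∫ x in l..r, F x * deriv b x = γ * (b r - b l) := by
    have hae : (fun x => γ * deriv b x) =ᵐ[volume.restrict (uIoc l r)]
        fun x => F x * deriv b x := by
      rw [uIoc_of_le hlr, ← restrict_Ioo_eq_restrict_Ioc]
      exact (ae_restrict_iff' measurableSet_Ioo).2 (.of_forall fun x hx => by simp [hF x hx])
    refine ⟨((hbc.const_mul γ).intervalIntegrable l r).congr_ae hae, ?_⟩
    rw [← intervalIntegral.integral_congr_ae_restrict hae, intervalIntegral.integral_const_mul,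
      intervalIntegral.integral_deriv_eq_sub (fun x _ => hbd x) (hbc.intervalIntegrable _ _)]
  have hFsupp : Function.support (fun x => F x * deriv b x) ⊆ Ioc c e := fun x hx =>
    Ioo_subset_Ioc_self (hsupp (support_deriv_subset (right_ne_zero_of_mul hx)))
  obtain ⟨hil, hvl⟩ := hpiece hcd hleft
  obtain ⟨hir, hvr⟩ := hpiece hde hright
  refine ⟨(integrableOn_iff_integrable_of_support_subset hFsupp).1 (hil.trans hir).1, ?_⟩
  rw [← intervalIntegral.integral_eq_integral_of_support_subset hFsupp,
    ← intervalIntegral.integral_add_adjacent_intervals hil hir, hvl, hvr,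
    hzero (x := c) (by simp), hzero (x := e) (by simp)]
  ring

/-- The periodic stumpon of the Camassa–Holm equation (a periodic cuspon with
parameters `z < m < s < M` glued along a plateau of height `s` and half-width `ℓ`,
with traveling-wave constant `a = s²`) does not satisfy the energy conservation law
`(u² + u_x²)_t + (u(u² + u_x²))_x = (u³ − 2Pu)_x` in the weak sense: there is a test
function `Φ` for which the corresponding double integral does not vanish. -/
theorem periodic_stumpon_not_conservative (M m s z L ℓ : ℝ)
    (hzm : z < m) (hms : m < s) (hsM : s < M)
    (hz : z = s - M - m) (ha : s ^ 2 = -(M * m) - (M + m) * z)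
    (hL : 0 < L) (hℓ : 0 < ℓ) (ψ ψ' : ℝ → ℝ)
    (hcont : Continuous ψ) (heven : ∀ x, ψ (-x) = ψ x)
    (hper : Function.Periodic ψ (2 * (L + ℓ)))
    (hplat : ∀ x : ℝ, |x| ≤ ℓ → ψ x = s)
    (hsmooth : ContDiffOn ℝ (⊤ : ℕ∞) ψ (Ioo ℓ (L + ℓ)))
    (hderiv : ∀ x ∈ Ioo ℓ (L + ℓ), HasDerivAt ψ (ψ' x) x)
    (hneg : ∀ x ∈ Ioo ℓ (L + ℓ), ψ' x < 0)
    (htrough : ψ (L + ℓ) = m)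
    (hode : ∀ x ∈ Ioo ℓ (L + ℓ),
      (s - ψ x) * (ψ' x) ^ 2 = (M - ψ x) * (ψ x - m) * (ψ x - z))
    (hψ'plat : ∀ x : ℝ, |x| ≤ ℓ → ψ' x = 0)
    (hψ'odd : ∀ x, ψ' (-x) = -ψ' x)
    (hψ'per : Function.Periodic ψ' (2 * (L + ℓ))) :
    ∃ Φ : ℝ → ℝ → ℝ,
      ContDiff ℝ (⊤ : ℕ∞) (fun p : ℝ × ℝ => Φ p.1 p.2) ∧
      HasCompactSupport (fun p : ℝ × ℝ => Φ p.1 p.2) ∧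
      (∫ t : ℝ, ∫ x : ℝ,
        ((ψ (x - s * t)) ^ 2 + (ψ' (x - s * t)) ^ 2) * deriv (fun τ => Φ τ x) t
          + (ψ (x - s * t) * ((ψ (x - s * t)) ^ 2 + (ψ' (x - s * t)) ^ 2)
              - (ψ (x - s * t)) ^ 3
              + 2 * (s ^ 2 - (1 / 2) * (s - ψ (x - s * t)) ^ 2) * ψ (x - s * t))
            * deriv (Φ t) x) ≠ 0 := by
  have hlt : ∀ x ∈ Ioo ℓ (L + ℓ), ψ x < s := by
    have hanti : StrictAntiOn ψ (Icc ℓ (L + ℓ)) := by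
      refine strictAntiOn_of_deriv_neg (convex_Icc _ _) hcont.continuousOn fun x hx => ?_
      rw [interior_Icc] at hx
      rw [(hderiv x hx).deriv]
      exact hneg x hx
    intro x hx
    rw [← hplat ℓ (abs_of_pos hℓ).le]
    exact hanti ⟨le_rfl, by linarith⟩ (Ioo_subset_Icc_self hx) hx.1
  have hr : 0 < min ℓ L := lt_min hℓ hL
  let a : ContDiffBump (0 : ℝ) := ⟨1, 2, one_pos, one_lt_two⟩
  let b : ContDiffBump ℓ := ⟨min ℓ L / 4, min ℓ L / 2, by linarith, by linarith⟩
  have hbsupp : tsupport b ⊆ Ioo 0 (L + ℓ) := by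
    rw [b.tsupport_eq, Real.closedBall_eq_Icc]
    intro x hx
    have hbr : b.rOut = min ℓ L / 2 := rfl
    rw [hbr] at hx
    have := min_le_left ℓ L
    have := min_le_right ℓ L
    constructor <;> linarith [hx.1, hx.2]
  have hplat' : ∀ x ∈ Icc 0 ℓ, |x| ≤ ℓ := fun x hx => (abs_of_nonneg hx.1).trans_le hx.2
  set E : ℝ → ℝ := fun ξ => ψ ξ ^ 2 + ψ' ξ ^ 2 with hE
  set G : ℝ → ℝ := fun ξ => ψ ξ * (ψ ξ ^ 2 + ψ' ξ ^ 2) - ψ ξ ^ 3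
    + 2 * (s ^ 2 - 1 / 2 * (s - ψ ξ) ^ 2) * ψ ξ with hG
  have hEint : Integrable fun ξ => E ξ * b ξ := by
    have hsq : IntervalIntegrable (fun x => ψ' x ^ 2) volume 0 (L + ℓ) := by
      refine IntervalIntegrable.trans (b := ℓ) ?_ ?_
      · refine (intervalIntegrable_const (c := (0 : ℝ))).congr fun x hx => ?_
        rw [uIoc_of_le hℓ.le] at hx
        simp [hψ'plat x (hplat' x (Ioc_subset_Icc_self hx))]
      · exact intervalIntegrable_sq_of_cusp
          (p := fun x => (M - ψ x) * (ψ x - m) * (ψ x - z)) (by linarith) hcont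
          (by fun_prop) hderiv hneg hlt hode
    have hEb := (((hcont.pow 2).intervalIntegrable 0 (L + ℓ)).add hsq).mul_continuousOn
      b.continuous.continuousOn
    exact (integrableOn_iff_integrable_of_support_subset fun x hx => Ioo_subset_Ioc_self
      (hbsupp (subset_tsupport _ (right_ne_zero_of_mul hx)))).1 hEb.1
  obtain ⟨hFint, hFval⟩ := integral_step_mul_deriv (F := fun ξ => G ξ - s * E ξ) (b := b)
    (α := s ^ 3) (β := -(M * m * z)) hℓ.le (by linarith) b.contDiff hbsupp
    (fun x hx => by
      have hx' := hplat' x (Ioo_subset_Icc_self hx)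
      simp only [hE, hG, hplat x hx', hψ'plat x hx']
      ring)
    (fun x hx => by
      simp only [hE, hG]
      linear_combination -hode x hx + ψ x * ha - ψ x ^ 2 * hz)
  refine ⟨fun t x => a t * b (x - s * t), ?_,
    hasCompactSupport_movingFrame a.hasCompactSupport b.hasCompactSupport s, ?_⟩
  · exact (a.contDiff.comp contDiff_fst).mul
      (b.contDiff.comp (contDiff_snd.sub (contDiff_const.mul contDiff_fst)))
  · have hval := (integral_movingFrame a.contDiff b.contDiff a.hasCompactSupport
      hEint hFint).trans (congrArg _ hFval)
    have hbℓ : b ℓ = 1 := b.one_of_mem_closedBall (Metric.mem_closedBall_self b.rIn_pos.le)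
    have hjump : 0 < (M - s) * (s - m) * (s - z) :=
      mul_pos (mul_pos (by linarith) (by linarith)) (by linarith)
    have hjump' : s ^ 3 - -(M * m * z) = (M - s) * (s - m) * (s - z) := by
      linear_combination s * ha - s ^ 2 * hz
    refine hval.trans_ne ?_
    rw [hbℓ, mul_one, hjump']
    exact mul_ne_zero a.integral_pos.ne' hjump.ne'
end

section
/- Let M, m, s, z ∈ ℝ satisfy z < m < s < M and z = s − M − m, and set a = −M·m − (M+m)·z. Let L > 0 and let φ : ℝ → ℝ be continuous, even, periodic with period 2L, with φ(0) = s, φ infinitely differentiable on (0, L) with φ'(x) < 0 there, φ(L) = m, and (s − φ(x))·φ'(x)² = (M − φ(x))·(φ(x) − m)·(φ(x) − z) for all x ∈ (0, L). Set u(t,x) = φ(x − s·t), u_x(t,x) = φ'(x − s·t) (defined almost everywhere), and P(t,x) = (a + s² − (s − φ(x − s·t))²)/2. Then the energy conservation law holds weakly: for every test function Φ ∈ C_c^∞(ℝ × ℝ), ∬_{ℝ²} [ (u² + u_x²)·∂_tΦ + ( u·(u² + u_x²) − u³ + 2·P·u )·∂_xΦ ] dx dt = 0. -/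
open MeasureTheory Set

theorem locallyIntegrable_comp_snd {E : ℝ → ℝ} (hE : LocallyIntegrable E) :
    LocallyIntegrable (fun p : ℝ × ℝ => E p.2) := by
  refine locallyIntegrable_iff.2 fun K hK => ?_
  have hsub : K ⊆ (Prod.fst '' K) ×ˢ (Prod.snd '' K) := fun p hp => ⟨⟨p, hp, rfl⟩, ⟨p, hp, rfl⟩⟩
  have h1 : IsCompact (Prod.fst '' K) := hK.image continuous_fst
  have h2 : IsCompact (Prod.snd '' K) := hK.image continuous_snd
  refine IntegrableOn.mono_set ?_ hsub
  rw [IntegrableOn, Measure.volume_eq_prod, ← Measure.prod_restrict]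
  have : IsFiniteMeasure ((volume : Measure ℝ).restrict (Prod.fst '' K)) :=
    ⟨by simpa using h1.measure_lt_top⟩
  exact (hE.integrableOn_isCompact h2).comp_snd _

/-- A density `E` that is constant in time, with a flux `G` that is almost everywhere constant in
space, is weakly conserved. -/
theorem integral_integral_stationary_conservation {E G : ℝ → ℝ} {c : ℝ}
    (hE : LocallyIntegrable E) (hG : ∀ᵐ x, G x = c) {g : ℝ × ℝ → ℝ}
    (hg : ContDiff ℝ 1 g) (hsupp : HasCompactSupport g) :
    ∫ t : ℝ, ∫ x : ℝ, (E x * fderiv ℝ g (t, x) (1, 0) + G x * fderiv ℝ g (t, x) (0, 1)) = 0 := by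
  have hcont (v : ℝ × ℝ) : Continuous fun p => fderiv ℝ g p v :=
    (hg.continuous_fderiv one_ne_zero).clm_apply continuous_const
  have hcomp (v : ℝ × ℝ) : HasCompactSupport fun p => fderiv ℝ g p v := hsupp.fderiv_apply ℝ v
  have hsliceX (t : ℝ) : Topology.IsClosedEmbedding fun x : ℝ => (t, x) :=
    (Isometry.of_dist_eq fun a b => by simp [Prod.dist_eq]).isClosedEmbedding
  have hsliceT (x : ℝ) : Topology.IsClosedEmbedding fun t : ℝ => (t, x) :=
    (Isometry.of_dist_eq fun a b => by simp [Prod.dist_eq]).isClosedEmbedding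
  have hdX (t x : ℝ) : HasDerivAt (fun y => g (t, y)) (fderiv ℝ g (t, x) (0, 1)) x :=
    ((hg.differentiable one_ne_zero) (t, x)).hasFDerivAt.comp_hasDerivAt x
      ((hasDerivAt_const x t).prodMk (hasDerivAt_id x))
  have hdT (t x : ℝ) : HasDerivAt (fun τ => g (τ, x)) (fderiv ℝ g (t, x) (1, 0)) t :=
    ((hg.differentiable one_ne_zero) (t, x)).hasFDerivAt.comp_hasDerivAt t
      ((hasDerivAt_id t).prodMk (hasDerivAt_const t x))
  have hX (t : ℝ) : Integrable fun x => fderiv ℝ g (t, x) (0, 1) :=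
    ((hcont _).comp (hsliceX t).continuous).integrable_of_hasCompactSupport
      ((hcomp _).comp_isClosedEmbedding (hsliceX t))
  have hT (x : ℝ) : Integrable fun t => fderiv ℝ g (t, x) (1, 0) :=
    ((hcont _).comp (hsliceT x).continuous).integrable_of_hasCompactSupport
      ((hcomp _).comp_isClosedEmbedding (hsliceT x))
  have hflux (t : ℝ) : (fun x => G x * fderiv ℝ g (t, x) (0, 1)) =ᵐ[volume]
      fun x => c * fderiv ℝ g (t, x) (0, 1) := by
    filter_upwards [hG] with x hx using by rw [hx]
  have hinner (t : ℝ) :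
      ∫ x : ℝ, (E x * fderiv ℝ g (t, x) (1, 0) + G x * fderiv ℝ g (t, x) (0, 1)) =
        ∫ x : ℝ, E x * fderiv ℝ g (t, x) (1, 0) := by
    have hdensity : Integrable fun x => E x * fderiv ℝ g (t, x) (1, 0) :=
      hE.integrable_smul_right_of_hasCompactSupport
        ((hcont (1, 0)).comp (hsliceX t).continuous)
        ((hcomp _).comp_isClosedEmbedding (hsliceX t))
    rw [integral_add hdensity (((hX t).const_mul c).congr (hflux t).symm), integral_congr_ae (hflux t),
      integral_const_mul, integral_eq_zero_of_hasDerivAt_of_integrable (hdX t) (hX t)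
        ((hg.continuous.comp (hsliceX t).continuous).integrable_of_hasCompactSupport
          (hsupp.comp_isClosedEmbedding (hsliceX t)))]
    simp
  simp_rw [hinner]
  rw [integral_integral_swap
    ((locallyIntegrable_comp_snd hE).integrable_smul_right_of_hasCompactSupport
      (hcont (1, 0)) (hcomp _))]
  refine integral_eq_zero_of_ae (.of_forall fun x => ?_)
  simp only [integral_const_mul]
  rw [integral_eq_zero_of_hasDerivAt_of_integrable (fun t => hdT t x) (hT x)
    ((hg.continuous.comp (hsliceT x).continuous).integrable_of_hasCompactSupport
      (hsupp.comp_isClosedEmbedding (hsliceT x)))]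
  simp

/-- Weak conservation in the frame moving with speed `s`. -/
theorem integral_integral_travelling_conservation {E F : ℝ → ℝ} {c s : ℝ}
    (hE : LocallyIntegrable E) (hF : ∀ᵐ x, F x - s * E x = c) {f : ℝ × ℝ → ℝ}
    (hf : ContDiff ℝ 1 f) (hsupp : HasCompactSupport f) :
    ∫ t : ℝ, ∫ x : ℝ, (E (x - s * t) * deriv (fun τ => f (τ, x)) t +
      F (x - s * t) * deriv (fun y => f (t, y)) x) = 0 := by
  let T : (ℝ × ℝ) ≃ₜ (ℝ × ℝ) :=
    { toFun := fun p => (p.1, p.2 + s * p.1)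
      invFun := fun p => (p.1, p.2 - s * p.1)
      left_inv := fun p => by simp
      right_inv := fun p => by simp
      continuous_toFun := by fun_prop
      continuous_invFun := by fun_prop }
  have hT : ContDiff ℝ 1 T := by
    change ContDiff ℝ 1 fun p : ℝ × ℝ => (p.1, p.2 + s * p.1)
    fun_prop
  have hfT : ContDiff ℝ 1 (f ∘ T) := hf.comp hT
  have hdiff := hf.differentiable one_ne_zero
  have hline (t x : ℝ) : HasDerivAt (fun τ => f (τ, x + s * τ))
      (deriv (fun τ => f (τ, x + s * t)) t + s * deriv (fun y => f (t, y)) (x + s * t)) t := by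
    have h1 := (hdiff (t, x + s * t)).hasFDerivAt.comp_hasDerivAt t
      ((hasDerivAt_id t).prodMk (hasDerivAt_const t (x + s * t)))
    have h2 := (hdiff (t, x + s * t)).hasFDerivAt.comp_hasDerivAt (x + s * t)
      ((hasDerivAt_const (x + s * t) t).prodMk (hasDerivAt_id (x + s * t)))
    have h3 := (hdiff (t, x + s * t)).hasFDerivAt.comp_hasDerivAt t
      ((hasDerivAt_id t).prodMk (((hasDerivAt_id t).const_mul s).const_add x))
    have e1 : deriv (fun τ => f (τ, x + s * t)) t = _ := h1.deriv
    have e2 : deriv (fun y => f (t, y)) (x + s * t) = _ := h2.deriv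
    rw [e1, e2]
    refine h3.congr_deriv ?_
    have hv : ((1 : ℝ), s * 1) = (1, 0) + s • (0, 1) := by simp
    rw [hv, map_add, map_smul, smul_eq_mul]
  have hdt (t x : ℝ) : fderiv ℝ (f ∘ T) (t, x) (1, 0) =
      deriv (fun τ => f (τ, x + s * t)) t + s * deriv (fun y => f (t, y)) (x + s * t) :=
    (((hfT.differentiable one_ne_zero) (t, x)).hasFDerivAt.comp_hasDerivAt (f := (·, x)) t
      ((hasDerivAt_id t).prodMk (hasDerivAt_const t x))).unique (hline t x)
  have hdx (t x : ℝ) : fderiv ℝ (f ∘ T) (t, x) (0, 1) =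
      deriv (fun y => f (t, y)) (x + s * t) := by
    rw [← deriv_comp_add_const]
    exact (((hfT.differentiable one_ne_zero) (t, x)).hasFDerivAt.comp_hasDerivAt x
      ((hasDerivAt_const x t).prodMk (hasDerivAt_id x))).deriv.symm
  rw [← integral_integral_stationary_conservation hE hF hfT (hsupp.comp_homeomorph T)]
  refine integral_congr_ae (.of_forall fun t => ?_)
  dsimp only
  rw [← integral_add_right_eq_self _ (s * t)]
  refine integral_congr_ae (.of_forall fun x => ?_)
  simp only [add_sub_cancel_right, hdt, hdx]
  ring

/-- The squared slope of a cusp is integrable up to the cusp. -/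
theorem integrableOn_sq_slope_of_cusp {M m s z L : ℝ} (hzm : z < m) (hsM : s < M)
    {φ φ' : ℝ → ℝ} (hcont : Continuous φ)
    (hrange : ∀ x ∈ Ioo (0 : ℝ) L, φ x ∈ Ioo m s)
    (hderiv : ∀ x ∈ Ioo (0 : ℝ) L, HasDerivAt φ (φ' x) x)
    (hneg : ∀ x ∈ Ioo (0 : ℝ) L, φ' x < 0)
    (hode : ∀ x ∈ Ioo (0 : ℝ) L,
      (s - φ x) * (φ' x) ^ 2 = (M - φ x) * (φ x - m) * (φ x - z)) :
    IntegrableOn (fun x => φ' x ^ 2) (Ioc 0 L) := by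
  have hroot : ∀ x ∈ Ioo (0 : ℝ) L,
      HasDerivAt (fun y => 2 * √(s - φ y)) (-φ' x / √(s - φ x)) x := by
    intro x hx
    have hpos : 0 < s - φ x := sub_pos.2 (hrange x hx).2
    have h := (((hderiv x hx).const_sub s).sqrt hpos.ne').const_mul 2
    refine h.congr_deriv ?_
    have := Real.sqrt_pos.2 hpos
    field_simp
  have hint : IntegrableOn (fun x => -φ' x / √(s - φ x)) (Ioc 0 L) :=
    intervalIntegral.integrableOn_deriv_of_nonneg (by fun_prop) hroot fun x hx =>
      div_nonneg (neg_nonneg.2 (hneg x hx).le) (Real.sqrt_nonneg _)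
  rw [integrableOn_Ioc_iff_integrableOn_Ioo] at hint ⊢
  refine (hint.const_mul √((M - m) * (s - m) * (s - z))).mono' ?_ ?_
  · refine ((measurable_deriv φ).pow_const 2).aestronglyMeasurable.congr ?_
    filter_upwards [ae_restrict_mem measurableSet_Ioo] with x hx using by rw [(hderiv x hx).deriv]
  · filter_upwards [ae_restrict_mem measurableSet_Ioo] with x hx
    obtain ⟨hm, hs⟩ := hrange x hx
    have hpos : 0 < s - φ x := sub_pos.2 hs
    have hsq : (-φ' x * √(s - φ x)) ^ 2 ≤ (M - m) * (s - m) * (s - z) := by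
      rw [mul_pow, Real.sq_sqrt hpos.le, neg_sq, mul_comm, hode x hx]
      gcongr <;> first | linarith | (apply mul_nonneg <;> linarith)
    have hle := (le_abs_self _).trans (Real.abs_le_sqrt hsq)
    have hr := Real.sqrt_pos.2 hpos
    have hg : 0 ≤ -φ' x / √(s - φ x) := div_nonneg (neg_nonneg.2 (hneg x hx).le) hr.le
    rw [Real.norm_of_nonneg (sq_nonneg _)]
    refine le_trans (le_of_eq ?_) (mul_le_mul_of_nonneg_right hle hg)
    field_simp

/-- An even periodic function integrable over half a period is locally integrable. -/
theorem locallyIntegrable_of_even_of_periodic {h : ℝ → ℝ} {L : ℝ} (hL : 0 < L)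
    (heven : ∀ x, h (-x) = h x) (hper : Function.Periodic h (2 * L))
    (hint : IntegrableOn h (Ioc 0 L)) : LocallyIntegrable h := by
  have hpos : IntervalIntegrable h volume 0 L :=
    (intervalIntegrable_iff_integrableOn_Ioc_of_le hL.le).2 hint
  have hneg : IntervalIntegrable h volume (-L) 0 := by
    simpa [heven] using (IntervalIntegrable.iff_comp_neg (by finiteness) |>.1 hpos).symm
  have hall := hper.intervalIntegrable (by positivity) (t := -L)
    (by simpa [two_mul] using hneg.trans hpos)
  refine locallyIntegrable_iff.2 fun K hK => ?_
  refine IntegrableOn.mono_set ?_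
    (hK.isBounded.subset_Icc_sInf_sSup.trans (Icc_subset_Icc_right (le_max_right (sInf K) _)))
  rw [integrableOn_Icc_iff_integrableOn_Ioc,
    ← intervalIntegrable_iff_integrableOn_Ioc_of_le (le_max_left _ _)]
  exact hall _ _

/-- An even periodic property holding inside half a period holds almost everywhere. -/
theorem ae_of_even_of_periodic {p : ℝ → Prop} {L : ℝ} (hL : 0 < L)
    (heven : ∀ x, p x → p (-x)) (hper : Function.Periodic p (2 * L))
    (hp : ∀ x ∈ Ioo 0 L, p x) : ∀ᵐ x : ℝ, p x := by
  have hnull : volume (range fun k : ℤ => (k : ℝ) * L) = 0 := (countable_range _).measure_zero _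
  filter_upwards [compl_mem_ae_iff.2 hnull] with x hx
  obtain ⟨k, hk, -⟩ := existsUnique_add_zsmul_mem_Ioc (by positivity : 0 < 2 * L) x (-L)
  rw [← (hper.zsmul k) x]
  set y := x + k • (2 * L) with hy
  have hne (j : ℤ) : y ≠ j * L := fun h => hx ⟨j - 2 * k, by
    simp only [zsmul_eq_mul] at hy
    push_cast
    linarith⟩
  have h0 : y ≠ 0 := by simpa using hne 0
  have h1 : y ≠ L := by simpa using hne 1
  obtain ⟨hk1, hk2⟩ := hk
  have hk3 : y < L := lt_of_le_of_ne (by linarith) h1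
  rcases lt_or_gt_of_ne h0 with h | h
  · simpa using heven _ (hp (-y) ⟨by linarith, by linarith⟩)
  · exact hp y ⟨h, hk3⟩

/-- The periodic cuspon of the Camassa–Holm equation (parameters `z < m < s < M`, a
`2L`-periodic wave with a cusp of height `s` at `x = 0` and trough `m` at `x = L`)
satisfies the energy conservation law
`(u² + u_x²)_t + (u(u² + u_x²))_x = (u³ − 2Pu)_x` in the weak sense: for every test
function `Φ` the corresponding double integral vanishes. Here `a = −Mm − (M+m)z` and
`P(t,x) = (a + s² − (s − φ(x − st))²)/2`. -/
theorem periodic_cuspon_conservative (M m s z a L : ℝ)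
    (hzm : z < m) (hms : m < s) (hsM : s < M)
    (hz : z = s - M - m) (ha : a = -(M * m) - (M + m) * z)
    (hL : 0 < L) (φ φ' : ℝ → ℝ)
    (hcont : Continuous φ) (heven : ∀ x, φ (-x) = φ x)
    (hper : Function.Periodic φ (2 * L))
    (hcusp : φ 0 = s)
    (hsmooth : ContDiffOn ℝ (⊤ : ℕ∞) φ (Ioo 0 L))
    (hderiv : ∀ x ∈ Ioo (0 : ℝ) L, HasDerivAt φ (φ' x) x)
    (hneg : ∀ x ∈ Ioo (0 : ℝ) L, φ' x < 0)
    (htrough : φ L = m)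
    (hode : ∀ x ∈ Ioo (0 : ℝ) L,
      (s - φ x) * (φ' x) ^ 2 = (M - φ x) * (φ x - m) * (φ x - z))
    (hφ'odd : ∀ x, φ' (-x) = -φ' x)
    (hφ'per : Function.Periodic φ' (2 * L)) :
    ∀ Φ : ℝ → ℝ → ℝ,
      ContDiff ℝ (⊤ : ℕ∞) (fun p : ℝ × ℝ => Φ p.1 p.2) →
      HasCompactSupport (fun p : ℝ × ℝ => Φ p.1 p.2) →
      (∫ t : ℝ, ∫ x : ℝ,
        ((φ (x - s * t)) ^ 2 + (φ' (x - s * t)) ^ 2) * deriv (fun τ => Φ τ x) t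
          + (φ (x - s * t) * ((φ (x - s * t)) ^ 2 + (φ' (x - s * t)) ^ 2)
              - (φ (x - s * t)) ^ 3
              + 2 * ((a + s ^ 2 - (s - φ (x - s * t)) ^ 2) / 2) * φ (x - s * t))
            * deriv (Φ t) x) = 0 := by
  intro Φ hΦ hsupp
  have hanti : StrictAntiOn φ (Icc 0 L) :=
    strictAntiOn_of_deriv_neg (convex_Icc 0 L) hcont.continuousOn fun x hx => by
      rw [interior_Icc] at hx
      rw [(hderiv x hx).deriv]
      exact hneg x hx
  have hrange : ∀ x ∈ Ioo (0 : ℝ) L, φ x ∈ Ioo m s := fun x hx =>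
    ⟨htrough ▸ hanti (Ioo_subset_Icc_self hx) (right_mem_Icc.2 hL.le) hx.2,
      hcusp ▸ hanti (left_mem_Icc.2 hL.le) (Ioo_subset_Icc_self hx) hx.1⟩
  have hslope : LocallyIntegrable fun x => φ' x ^ 2 :=
    locallyIntegrable_of_even_of_periodic hL (fun x => by simp [hφ'odd])
      (fun x => by simp [hφ'per x])
      (integrableOn_sq_slope_of_cusp hzm hsM hcont hrange hderiv hneg hode)
  have henergy : LocallyIntegrable fun x => φ x ^ 2 + φ' x ^ 2 :=
    (hcont.pow 2).locallyIntegrable.add hslope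
  have hflux : ∀ᵐ x, (φ x * (φ x ^ 2 + φ' x ^ 2) - φ x ^ 3
      + 2 * ((a + s ^ 2 - (s - φ x) ^ 2) / 2) * φ x) - s * (φ x ^ 2 + φ' x ^ 2)
      = -(M * m * z) := by
    refine ae_of_even_of_periodic hL (fun x hx => ?_) (fun x => ?_) fun x hx => ?_
    · simpa only [heven, hφ'odd, neg_sq] using hx
    · simp only [hper x, hφ'per x]
    · have h := hode x hx
      subst ha
      have hs : s = z + M + m := by linarith
      subst hs
      linear_combination -h
  exact integral_integral_travelling_conservation henergy hflux
    (hΦ.of_le (by exact_mod_cast le_top)) hsupp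
end

section
/- Let M, m, s, z, L, ℓ, ψ, u, u_x, P be as follows: z < m < s < M, z = s − M − m, s² = −M·m − (M+m)·z, L, ℓ > 0, and ψ : ℝ → ℝ continuous, even, 2(L+ℓ)-periodic, with ψ = s on [−ℓ, ℓ], ψ smooth on (ℓ, L+ℓ) with ψ' < 0 there, ψ(L+ℓ) = m, and (s − ψ)·(ψ')² = (M−ψ)(ψ−m)(ψ−z) on (ℓ, L+ℓ); set u(t,x) = ψ(x − st), u_x(t,x) = ψ'(x − st) (a.e.), P(t,x) = s² − (1/2)(s − ψ(x − st))². Let Ω₁ = {(t,x) ∈ ℝ² : s·t − ℓ − 2L < x < s·t − ℓ}. Then for every Φ ∈ C_c^∞(ℝ × ℝ) whose support is contained in {(t,x) : s·t − ℓ − 2L < x < s·t + ℓ}, one has ∬_{Ω₁} [ (u² + u_x²)·∂_tΦ + ( u·(u² + u_x²) − u³ + 2·P·u )·∂_xΦ ] dx dt = ( s³ − (M−s)·(s−m)·(s−z) ) · ∫_ℝ Φ(t, s·t − ℓ) dt. -/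
open MeasureTheory Set

/-- A compactly supported function on `ℝ × ℝ` vanishes outside a vertical strip. -/
lemma HasCompactSupport.exists_eq_zero_of_lt_abs_fst {G : ℝ × ℝ → ℝ} (hG : HasCompactSupport G) :
    ∃ T : ℝ, ∀ p : ℝ × ℝ, T < |p.1| → G p = 0 := by
  obtain ⟨T, hT⟩ := (IsCompact.isBounded hG).subset_closedBall 0
  refine ⟨T, fun p hp => ?_⟩
  by_contra h
  have h1 := hT (subset_tsupport G h)
  rw [mem_closedBall_zero_iff] at h1
  have h2 := norm_fst_le p
  rw [Real.norm_eq_abs] at h2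
  linarith

/-- Restrictions of continuous compactly supported functions on `ℝ × ℝ` to non-vertical lines
are integrable. -/
lemma integrable_comp_line {G : ℝ × ℝ → ℝ} (hG : Continuous G) (hc : HasCompactSupport G)
    (s ξ : ℝ) : Integrable (fun t : ℝ => G (t, ξ + s * t)) := by
  obtain ⟨T, hT⟩ := hc.exists_eq_zero_of_lt_abs_fst
  refine Continuous.integrable_of_hasCompactSupport (by fun_prop)
    (HasCompactSupport.intro (isCompact_Icc (a := -T) (b := T)) fun t ht => hT _ ?_)
  by_contra! h
  exact ht (abs_le.mp h)

/-- An integrable weight in the moving coordinate times a continuous compactly supported function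
is integrable on the plane. -/
lemma integrable_mul_comp_shear {μ : Measure ℝ} [SFinite μ] {E : ℝ → ℝ} (hE : Integrable E μ)
    {G : ℝ × ℝ → ℝ} (hG : Continuous G) (hc : HasCompactSupport G) (s : ℝ) :
    Integrable (fun p : ℝ × ℝ => E p.2 * G (p.1, p.2 + s * p.1))
      ((volume : Measure ℝ).prod μ) := by
  obtain ⟨T, hT⟩ := hc.exists_eq_zero_of_lt_abs_fst
  obtain ⟨B, hB⟩ := hG.bounded_above_of_compact_support hc
  have hone : Integrable ((Icc (-T) T).indicator (fun _ => (1 : ℝ))) :=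
    (integrable_indicator_iff measurableSet_Icc).2 (by simp)
  have hbdd := (hone.mul_prod hE).mul_bdd (g := fun p : ℝ × ℝ => G (p.1, p.2 + s * p.1)) (c := B)
    (by fun_prop) (Filter.Eventually.of_forall fun p => hB _)
  refine hbdd.congr (Filter.Eventually.of_forall fun p => ?_)
  by_cases hp : p.1 ∈ Icc (-T) T
  · simp [hp]
  · have h0 : G (p.1, p.2 + s * p.1) = 0 :=
      hT _ (by by_contra! h; exact hp (abs_le.mp h))
    simp [h0]

/-- Derivative of a function along a line in the plane. -/
lemma hasDerivAt_comp_line {F : ℝ × ℝ → ℝ} (hF : Differentiable ℝ F) (s ξ t : ℝ) :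
    HasDerivAt (fun t : ℝ => F (t, ξ + s * t)) (fderiv ℝ F (t, ξ + s * t) (1, s)) t := by
  have h : HasDerivAt (fun t : ℝ => (t, ξ + s * t)) ((1 : ℝ), s) t := by
    refine (hasDerivAt_id t).prodMk ?_
    simpa using ((hasDerivAt_id t).const_mul s).const_add ξ
  exact (hF (t, ξ + s * t)).hasFDerivAt.comp_hasDerivAt t h

/-- A density transported along the lines `x - s t = ξ` is conserved: tested against the
derivative along these lines of a test function it integrates to zero. -/
lemma integral_integral_mul_fderiv_line_eq_zero {μ : Measure ℝ} [SFinite μ] {E : ℝ → ℝ}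
    (hE : Integrable E μ) {F : ℝ × ℝ → ℝ} (hF : ContDiff ℝ 1 F) (hc : HasCompactSupport F)
    (s : ℝ) : ∫ t : ℝ, ∫ ξ, E ξ * fderiv ℝ F (t, ξ + s * t) (1, s) ∂μ = 0 := by
  have hG : Continuous fun p => fderiv ℝ F p (1, s) :=
    (hF.continuous_fderiv (by simp)).clm_apply continuous_const
  have hGc : HasCompactSupport fun p => fderiv ℝ F p (1, s) := hc.fderiv_apply ℝ (1, s)
  rw [integral_integral_swap (integrable_mul_comp_shear hE hG hGc s)]
  refine integral_eq_zero_of_ae (Filter.Eventually.of_forall fun ξ => ?_)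
  simp only [integral_const_mul, Pi.zero_apply]
  rw [integral_eq_zero_of_hasDerivAt_of_integrable
    (hasDerivAt_comp_line (hF.differentiable (by simp)) s ξ)
    (integrable_comp_line hG hGc s ξ) (integrable_comp_line hF.continuous hc s ξ), mul_zero]

/-- If `ψ` decreases from `ψ a = s` and `(s - ψ) ψ'²` is bounded, then `ψ'²` is integrable. -/
lemma intervalIntegrable_sq_of_sub_mul_sq_le {ψ ψ' : ℝ → ℝ} {a b s C : ℝ} (hab : a ≤ b)
    (hcont : ContinuousOn ψ (Icc a b)) (ha : ψ a = s)
    (hderiv : ∀ x ∈ Ioo a b, HasDerivAt ψ (ψ' x) x) (hneg : ∀ x ∈ Ioo a b, ψ' x < 0)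
    (hC : ∀ x ∈ Ioo a b, (s - ψ x) * ψ' x ^ 2 ≤ C) :
    IntervalIntegrable (fun x => ψ' x ^ 2) volume a b := by
  have hanti : StrictAntiOn ψ (Icc a b) := by
    refine strictAntiOn_of_deriv_neg (convex_Icc a b) hcont fun x hx => ?_
    rw [interior_Icc] at hx
    rw [(hderiv x hx).deriv]
    exact hneg x hx
  have hpos : ∀ x ∈ Ioo a b, 0 < s - ψ x := fun x hx => by
    have := hanti (left_mem_Icc.2 hab) (Ioo_subset_Icc_self hx) hx.1
    linarith
  have hdom : IntegrableOn (fun x => 2 * √C * (-ψ' x / (2 * √(s - ψ x)))) (Ioc a b) := by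
    refine intervalIntegral.integrableOn_deriv_of_nonneg
      (g := fun x => 2 * √C * √(s - ψ x)) ?_ (fun x hx => ?_) (fun x hx => ?_)
    · exact continuousOn_const.mul (continuousOn_const.sub hcont).sqrt
    · exact (((hderiv x hx).const_sub s).sqrt (hpos x hx).ne').const_mul _
    · have := hneg x hx
      have h2 : 0 ≤ -ψ' x := by linarith
      positivity
  rw [intervalIntegrable_iff_integrableOn_Ioo_of_le hab]
  refine (hdom.mono_set Ioo_subset_Ioc_self).mono' ?_ ?_
  · refine (((measurable_deriv ψ).pow_const 2).aestronglyMeasurable).congr ?_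
    filter_upwards [ae_restrict_mem measurableSet_Ioo] with x hx
    rw [(hderiv x hx).deriv]
  · filter_upwards [ae_restrict_mem measurableSet_Ioo] with x hx
    have h1 := hpos x hx
    have h2 := hneg x hx
    have h3 : 0 < √(s - ψ x) := Real.sqrt_pos.2 h1
    have h4 : √(s - ψ x) * -ψ' x ≤ √C := by
      refine Real.le_sqrt_of_sq_le ?_
      rw [mul_pow, Real.sq_sqrt h1.le, neg_sq]
      exact hC x hx
    rw [Real.norm_of_nonneg (sq_nonneg _)]
    have h5 : 2 * √C * (-ψ' x / (2 * √(s - ψ x))) = √C * -ψ' x / √(s - ψ x) := by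
      field_simp
    rw [h5, le_div_iff₀ h3]
    nlinarith [mul_le_mul_of_nonneg_right h4 (neg_pos.2 h2).le]

/-- Integrability on a half period of an even periodic function extends to the adjacent full
period. -/
lemma IntervalIntegrable.of_even_periodic {q : ℝ → ℝ} {L ℓ : ℝ}
    (heven : ∀ x, q (-x) = q x) (hper : Function.Periodic q (2 * (L + ℓ)))
    (h : IntervalIntegrable q volume ℓ (L + ℓ)) :
    IntervalIntegrable q volume (-ℓ - 2 * L) (-ℓ) := by
  have h1 := h.comp_sub_left 0
  have h2 := h.comp_add_right (2 * (L + ℓ))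
  simp only [zero_sub, heven] at h1
  simp only [hper _] at h2
  have e1 : ℓ - 2 * (L + ℓ) = -ℓ - 2 * L := by ring
  have e2 : L + ℓ - 2 * (L + ℓ) = -(L + ℓ) := by ring
  rw [e1, e2] at h2
  exact h2.trans h1.symm

/-- Green's-theorem-type identity for the periodic stumpon of the Camassa–Holm
equation on the region `Ω₁ = {(t,x) : st − ℓ − 2L < x < st − ℓ}` between two
consecutive gluing lines: for every test function supported between the gluing lines
`x = st − ℓ − 2L` and `x = st + ℓ`, the energy-flux double integral over `Ω₁` equals
`(s³ − (M−s)(s−m)(s−z)) ∫ Φ(t, st − ℓ) dt`. -/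
theorem periodic_stumpon_flux_identity (M m s z L ℓ : ℝ)
    (hzm : z < m) (hms : m < s) (hsM : s < M)
    (hz : z = s - M - m) (ha : s ^ 2 = -(M * m) - (M + m) * z)
    (hL : 0 < L) (hℓ : 0 < ℓ) (ψ ψ' : ℝ → ℝ)
    (hcont : Continuous ψ) (heven : ∀ x, ψ (-x) = ψ x)
    (hper : Function.Periodic ψ (2 * (L + ℓ)))
    (hplat : ∀ x : ℝ, |x| ≤ ℓ → ψ x = s)
    (hsmooth : ContDiffOn ℝ (⊤ : ℕ∞) ψ (Ioo ℓ (L + ℓ)))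
    (hderiv : ∀ x ∈ Ioo ℓ (L + ℓ), HasDerivAt ψ (ψ' x) x)
    (hneg : ∀ x ∈ Ioo ℓ (L + ℓ), ψ' x < 0)
    (htrough : ψ (L + ℓ) = m)
    (hode : ∀ x ∈ Ioo ℓ (L + ℓ),
      (s - ψ x) * (ψ' x) ^ 2 = (M - ψ x) * (ψ x - m) * (ψ x - z))
    (hψ'plat : ∀ x : ℝ, |x| ≤ ℓ → ψ' x = 0)
    (hψ'odd : ∀ x, ψ' (-x) = -ψ' x)
    (hψ'per : Function.Periodic ψ' (2 * (L + ℓ))) :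
    ∀ Φ : ℝ → ℝ → ℝ,
      ContDiff ℝ (⊤ : ℕ∞) (fun p : ℝ × ℝ => Φ p.1 p.2) →
      HasCompactSupport (fun p : ℝ × ℝ => Φ p.1 p.2) →
      tsupport (fun p : ℝ × ℝ => Φ p.1 p.2)
        ⊆ {p : ℝ × ℝ | s * p.1 - ℓ - 2 * L < p.2 ∧ p.2 < s * p.1 + ℓ} →
      (∫ t : ℝ, ∫ x in Ioo (s * t - ℓ - 2 * L) (s * t - ℓ),
        ((ψ (x - s * t)) ^ 2 + (ψ' (x - s * t)) ^ 2) * deriv (fun τ => Φ τ x) t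
          + (ψ (x - s * t) * ((ψ (x - s * t)) ^ 2 + (ψ' (x - s * t)) ^ 2)
              - (ψ (x - s * t)) ^ 3
              + 2 * (s ^ 2 - (1 / 2) * (s - ψ (x - s * t)) ^ 2) * ψ (x - s * t))
            * deriv (Φ t) x)
        = (s ^ 3 - (M - s) * (s - m) * (s - z)) * ∫ t : ℝ, Φ t (s * t - ℓ) := by
  intro Φ hΦ hc hsupp
  set F : ℝ × ℝ → ℝ := fun p => Φ p.1 p.2 with hF
  have hF1 : ContDiff ℝ 1 F := hΦ.of_le (by exact_mod_cast le_top)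
  have hFd : Differentiable ℝ F := hF1.differentiable (by simp)
  set κ : ℝ := s ^ 3 - (M - s) * (s - m) * (s - z) with hκ
  set E : ℝ → ℝ := fun ξ => ψ ξ ^ 2 + ψ' ξ ^ 2 with hE
  have hab : -ℓ - 2 * L ≤ -ℓ := by linarith
  have hψℓ : ψ ℓ = s := hplat ℓ (abs_of_pos hℓ).le
  have hEint : IntervalIntegrable E volume (-ℓ - 2 * L) (-ℓ) := by
    obtain ⟨C, hC⟩ := (isCompact_Icc (a := ℓ) (b := L + ℓ)).exists_bound_of_continuousOn
      (f := fun x => (M - ψ x) * (ψ x - m) * (ψ x - z)) (by fun_prop)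
    have hq : IntervalIntegrable (fun x => ψ' x ^ 2) volume ℓ (L + ℓ) :=
      intervalIntegrable_sq_of_sub_mul_sq_le (C := C) (by linarith) hcont.continuousOn hψℓ
        hderiv hneg fun x hx => by
          rw [hode x hx]
          exact (le_abs_self _).trans (hC x (Ioo_subset_Icc_self hx))
    refine IntervalIntegrable.add ((hcont.pow 2).intervalIntegrable _ _) ?_
    exact hq.of_even_periodic (q := fun x => ψ' x ^ 2) (fun x => by simp [hψ'odd x])
      fun x => by simp [hψ'per x]
  have hodeE : ∀ ξ ∈ Ioo (-ℓ - 2 * L) (-ℓ), ξ ≠ -(L + ℓ) →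
      (s - ψ ξ) * ψ' ξ ^ 2 = (M - ψ ξ) * (ψ ξ - m) * (ψ ξ - z) := by
    intro ξ hξ hne
    rcases lt_or_gt_of_ne hne with h | h
    · have := hode (ξ + 2 * (L + ℓ)) ⟨by linarith [hξ.1], by linarith⟩
      rwa [hper, hψ'per] at this
    · have := hode (-ξ) ⟨by linarith [hξ.2], by linarith⟩
      rwa [heven, hψ'odd, neg_sq] at this
  have hflux : ∀ ξ ∈ Ioo (-ℓ - 2 * L) (-ℓ), ξ ≠ -(L + ℓ) →
      ψ ξ * E ξ - ψ ξ ^ 3 + 2 * (s ^ 2 - (1 / 2) * (s - ψ ξ) ^ 2) * ψ ξ = s * E ξ + κ := by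
    intro ξ hξ hne
    have h := hodeE ξ hξ hne
    have hcub : (M - ψ ξ) * (ψ ξ - m) * (ψ ξ - z)
        = (M - s) * (s - m) * (s - z) - s ^ 3 + s * ψ ξ ^ 2 + s ^ 2 * ψ ξ - ψ ξ ^ 3 := by
      have hs : M + m + z = s := by linarith
      linear_combination (ψ ξ ^ 2 - s ^ 2) * hs - (ψ ξ - s) * ha
    simp only [hE, hκ]
    linear_combination -h - hcub
  have hdt : ∀ t x : ℝ, deriv (fun τ => Φ τ x) t = fderiv ℝ F (t, x) (1, 0) := by
    intro t x
    have := (hFd (t, x)).hasFDerivAt.comp_hasDerivAt t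
      ((hasDerivAt_id t).prodMk (hasDerivAt_const t x))
    exact this.deriv
  have hdx : ∀ t x : ℝ, HasDerivAt (Φ t) (fderiv ℝ F (t, x) (0, 1)) x := by
    intro t x
    exact (hFd (t, x)).hasFDerivAt.comp_hasDerivAt x
      ((hasDerivAt_const x t).prodMk (hasDerivAt_id x))
  have hG : ∀ v, Continuous fun p => fderiv ℝ F p v := fun v =>
    (hF1.continuous_fderiv (by simp)).clm_apply continuous_const
  have hleft : ∀ t, Φ t (s * t - ℓ - 2 * L) = 0 := by
    intro t
    by_contra h
    have := hsupp (subset_tsupport F (a := (t, s * t - ℓ - 2 * L)) h)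
    exact lt_irrefl _ this.1
  have hinner : ∀ t : ℝ, (∫ x in Ioo (s * t - ℓ - 2 * L) (s * t - ℓ),
        ((ψ (x - s * t)) ^ 2 + (ψ' (x - s * t)) ^ 2) * deriv (fun τ => Φ τ x) t
          + (ψ (x - s * t) * ((ψ (x - s * t)) ^ 2 + (ψ' (x - s * t)) ^ 2)
              - (ψ (x - s * t)) ^ 3
              + 2 * (s ^ 2 - (1 / 2) * (s - ψ (x - s * t)) ^ 2) * ψ (x - s * t))
            * deriv (Φ t) x)
      = (∫ ξ in Ioc (-ℓ - 2 * L) (-ℓ), E ξ * fderiv ℝ F (t, ξ + s * t) (1, s))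
        + κ * Φ t (s * t - ℓ) := by
    intro t
    have e1 : s * t - ℓ - 2 * L = -ℓ - 2 * L + s * t := by ring
    have e2 : s * t - ℓ = -ℓ + s * t := by ring
    have hbd : ∫ ξ in (-ℓ - 2 * L)..(-ℓ), fderiv ℝ F (t, ξ + s * t) (0, 1)
        = Φ t (s * t - ℓ) := by
      rw [intervalIntegral.integral_comp_add_right
        (fun x => fderiv ℝ F (t, x) (0, 1)), ← e1, ← e2,
        intervalIntegral.integral_eq_sub_of_hasDerivAt (fun x _ => hdx t x), hleft, sub_zero]
      exact ((hG (0, 1)).comp (by fun_prop : Continuous fun x : ℝ => (t, x))).intervalIntegrable _ _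
    have hi1 : IntervalIntegrable (fun ξ => E ξ * fderiv ℝ F (t, ξ + s * t) (1, s))
        volume (-ℓ - 2 * L) (-ℓ) :=
      hEint.mul_continuousOn
        ((hG (1, s)).comp (by fun_prop : Continuous fun ξ : ℝ => (t, ξ + s * t))).continuousOn
    have hi2 : IntervalIntegrable (fun ξ => κ * fderiv ℝ F (t, ξ + s * t) (0, 1))
        volume (-ℓ - 2 * L) (-ℓ) :=
      (continuous_const.mul ((hG (0, 1)).comp
        (by fun_prop : Continuous fun ξ : ℝ => (t, ξ + s * t)))).intervalIntegrable _ _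
    rw [← hbd, ← intervalIntegral.integral_const_mul, ← intervalIntegral.integral_of_le hab,
      ← intervalIntegral.integral_add hi1 hi2, ← integral_Ioc_eq_integral_Ioo,
      ← intervalIntegral.integral_of_le (by linarith), e1, e2,
      ← intervalIntegral.integral_comp_add_right]
    refine intervalIntegral.integral_congr_ae ?_
    filter_upwards [Measure.ae_ne volume (-(L + ℓ)), Measure.ae_ne volume (-ℓ)]
      with ξ hne hne' hξ
    rw [uIoc_of_le hab] at hξ
    have h := hflux ξ ⟨hξ.1, lt_of_le_of_ne hξ.2 hne'⟩ hne
    have hv : ((1 : ℝ), s) = (1, 0) + s • ((0 : ℝ), (1 : ℝ)) := by simp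
    rw [add_sub_cancel_right, hdt, (hdx t _).deriv, hv, map_add, map_smul, smul_eq_mul]
    simp only [hE] at h ⊢
    rw [h]
    ring
  simp only [hinner]
  have hEint' : Integrable E (volume.restrict (Ioc (-ℓ - 2 * L) (-ℓ))) :=
    (intervalIntegrable_iff_integrableOn_Ioc_of_le hab).1 hEint
  have hA := (integrable_mul_comp_shear hEint' (hG (1, s))
    (hc.fderiv_apply ℝ (1, s)) s).integral_prod_left
  have hB : Integrable fun t => Φ t (s * t - ℓ) := by
    have := integrable_comp_line hF1.continuous hc s (-ℓ)
    simpa only [hF, neg_add_eq_sub] using this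
  rw [integral_add hA (hB.const_mul κ), integral_integral_mul_fderiv_line_eq_zero hEint' hF1 hc s,
    zero_add, integral_const_mul]
end

section
/- Let I ⊆ ℝ be an open interval (possibly unbounded) and f : ℝ → ℝ a function that is twice continuously differentiable on I, with f and f' bounded on I, such that f(z) → 0 and f'(z) → 0 as z tends from within I to any finite endpoint of I, and such that for the given x ∈ ℝ the function z ↦ e^{−|x−z|}·f''(z) is integrable on I. Then for every x ∉ I, ∫_I (1/2)·e^{−|x−z|}·( f(z) − f''(z) ) dz = 0. -/
open MeasureTheory Set Filter

/-- On an open interval, a primitive that tends to zero at both ends (finite or infinite) forces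
the integral to vanish. -/
theorem setIntegral_eq_zero_of_hasDerivAt_of_tendsto {I : Set ℝ} (hIopen : IsOpen I)
    (hIconn : I.OrdConnected) {G g : ℝ → ℝ} (hG : ∀ z ∈ I, HasDerivAt G (g z) z)
    (hint : IntegrableOn g I) (hends : ∀ c ∈ frontier I, Tendsto G (nhdsWithin c I) (nhds 0))
    (hbot : Tendsto G (atBot ⊓ 𝓟 I) (nhds 0)) (htop : Tendsto G (atTop ⊓ 𝓟 I) (nhds 0)) :
    ∫ z in I, g z = 0 := by
  have hform : (∃ a b, I = Ioo a b) ∨ (∃ a, I = Ioi a) ∨ (∃ b, I = Iio b) ∨ I = univ := by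
    have hI := hIopen.interior_eq
    have h := hIconn.isPreconnected.mem_intervals
    generalize sInf I = a at h
    generalize sSup I = b at h
    simp only [mem_insert_iff, mem_singleton_iff] at h
    rcases h with h | h | h | h | h | h | h | h | h | h <;> rw [h] at hI ⊢ <;>
      (try simp only [interior_Icc, interior_Ico, interior_Ioc, interior_Ici, interior_Iic] at hI) <;>
      first
      | exact .inl ⟨_, _, hI.symm⟩
      | exact .inr (.inl ⟨_, hI.symm⟩)
      | exact .inr (.inr (.inl ⟨_, hI.symm⟩))
      | exact .inl ⟨_, _, rfl⟩
      | exact .inr (.inl ⟨_, rfl⟩)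
      | exact .inr (.inr (.inl ⟨_, rfl⟩))
      | exact .inr (.inr (.inr rfl))
      | exact .inl ⟨0, 0, by simp⟩
  rcases hform with ⟨a, b, rfl⟩ | ⟨a, rfl⟩ | ⟨b, rfl⟩ | rfl
  · rcases le_or_gt b a with hab | hab
    · simp [Ioo_eq_empty hab.not_gt]
    · rw [frontier_Ioo hab] at hends
      have ha := hends a (by simp)
      have hb := hends b (by simp)
      rw [nhdsWithin_Ioo_eq_nhdsGT hab] at ha
      rw [nhdsWithin_Ioo_eq_nhdsLT hab] at hb
      have := intervalIntegral.integral_eq_sub_of_hasDerivAt_of_tendsto hab hG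
        ((intervalIntegrable_iff_integrableOn_Ioo_of_le hab.le).2 hint) ha hb
      rwa [intervalIntegral.integral_of_le hab.le, integral_Ioc_eq_integral_Ioo, sub_zero] at this
  · have ha := hends a (by simp)
    rw [inf_of_le_left (le_principal_iff.2 (Ioi_mem_atTop a))] at htop
    have := integral_Ioi_of_hasDerivAt_of_tendsto (f := Function.update G a 0) (f' := g) (m := 0)
      (continuousWithinAt_update_same.2 (by simpa using ha))
      (fun z hz => (hG z hz).congr_of_eventuallyEq
        ((eventually_ne_nhds (ne_of_gt hz)).mono fun y hy => Function.update_of_ne hy _ _)) hint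
      (htop.congr' ((eventually_ne_atTop a).mono fun y hy => (Function.update_of_ne hy _ _).symm))
    simpa using this
  · have hb := hends b (by simp)
    rw [inf_of_le_left (le_principal_iff.2 (Iio_mem_atBot b))] at hbot
    have := integral_Iic_of_hasDerivAt_of_tendsto (f := Function.update G b 0) (f' := g) (m := 0)
      (continuousWithinAt_update_same.2 (by simpa using hb))
      (fun z hz => (hG z hz).congr_of_eventuallyEq
        ((eventually_ne_nhds (ne_of_lt hz)).mono fun y hy => Function.update_of_ne hy _ _))
      ((integrableOn_Iic_iff_integrableOn_Iio (by finiteness)).2 hint)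
      (hbot.congr' ((eventually_ne_atBot b).mono fun y hy => (Function.update_of_ne hy _ _).symm))
    rw [← integral_Iic_eq_integral_Iio]
    simpa using this
  · simp only [principal_univ, inf_top_eq] at hbot htop
    simpa using integral_of_hasDerivAt_of_tendsto (fun z => hG z (mem_univ z))
      (integrableOn_univ.1 hint) hbot htop

theorem integrable_exp_neg_abs_sub (x : ℝ) : Integrable fun z : ℝ => Real.exp (-|x - z|) := by
  have h : Integrable fun z : ℝ => Real.exp (-|z|) := by
    rw [← integrableOn_univ, ← Iic_union_Ioi (a := (0 : ℝ))]
    refine IntegrableOn.union ?_ ?_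
    · refine (integrableOn_exp_Iic 0).congr_fun (fun z hz => ?_) measurableSet_Iic
      simp [abs_of_nonpos (mem_Iic.1 hz)]
    · refine (integrableOn_exp_neg_Ioi 0).congr_fun (fun z hz => ?_) measurableSet_Ioi
      simp [abs_of_pos (mem_Ioi.1 hz)]
  exact h.comp_sub_left x

/-- Off the diagonal, with `s = 1` to the left of `x` and `s = -1` to the right, the Helmholtz
kernel satisfies `∂_z e^{-|x-z|} = s e^{-|x-z|}`. -/
theorem hasDerivAt_exp_neg_abs_sub {x z : ℝ} (s : ℝ) (h : x ≠ z)
    (hs : s = SignType.sign (x - z)) :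
    HasDerivAt (fun y => Real.exp (-|x - y|)) (s * Real.exp (-|x - z|)) z := by
  have := ((hasDerivAt_abs (sub_ne_zero.2 h)).comp z
    ((hasDerivAt_id z).const_sub x)).neg.exp
  refine this.congr_deriv ?_
  change Real.exp (-|x - z|) * _ = _
  rw [hs]
  ring

/-- Integration-by-parts lemma for the Helmholtz kernel `½e^{−|x−z|}` on a single open
interval `I` of smoothness, in the case where the evaluation point `x` lies outside
`I`: if `f` is `C²` on `I` with `f`, `f'` bounded on `I` and vanishing at the finite
endpoints of `I`, and `z ↦ e^{−|x−z|} f''(z)` is integrable on `I`, then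
`∫_I ½e^{−|x−z|}(f(z) − f''(z)) dz = 0`. -/
theorem helmholtz_kernel_parts_outside (I : Set ℝ) (hIopen : IsOpen I)
    (hIconn : I.OrdConnected) (f f' f'' : ℝ → ℝ)
    (hf' : ∀ z ∈ I, HasDerivAt f (f' z) z)
    (hf'' : ∀ z ∈ I, HasDerivAt f' (f'' z) z)
    (hf''cont : ContinuousOn f'' I)
    (hbdd : ∃ C : ℝ, ∀ z ∈ I, |f z| ≤ C ∧ |f' z| ≤ C)
    (hends : ∀ c ∈ frontier I,
      Tendsto f (nhdsWithin c I) (nhds 0) ∧ Tendsto f' (nhdsWithin c I) (nhds 0))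
    (x : ℝ) (hx : x ∉ I)
    (hint : IntegrableOn (fun z => Real.exp (-|x - z|) * f'' z) I) :
    ∫ z in I, (1 / 2) * Real.exp (-|x - z|) * (f z - f'' z) = 0 := by
  obtain ⟨C, hC⟩ := hbdd
  have hne : ∀ z ∈ I, x ≠ z := fun z hz h => hx (h ▸ hz)
  obtain ⟨s, hs, hsI⟩ : ∃ s : ℝ, s * s = 1 ∧ ∀ z ∈ I, s = SignType.sign (x - z) := by
    by_cases h : ∃ y ∈ I, y < x
    · obtain ⟨y, hy, hyx⟩ := h
      refine ⟨1, by norm_num, fun z hz => ?_⟩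
      have hzx : z < x := lt_of_not_ge fun hxz => hx (hIconn.out hy hz ⟨hyx.le, hxz⟩)
      simp [sign_pos (sub_pos.2 hzx)]
    · push Not at h
      refine ⟨-1, by norm_num, fun z hz => ?_⟩
      simp [sign_neg (sub_neg.2 (lt_of_le_of_ne (h z hz) (hne z hz)))]
  have hcf : ContinuousOn f I := fun z hz => (hf' z hz).continuousAt.continuousWithinAt
  have hintf : IntegrableOn (fun z => Real.exp (-|x - z|) * f z) I :=
    (integrable_exp_neg_abs_sub x).integrableOn.mul_bdd
      (hcf.aestronglyMeasurable hIopen.measurableSet)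
      ((ae_restrict_iff' hIopen.measurableSet).2 (.of_forall fun z hz => (hC z hz).1))
  have hdecay : ∀ {l : Filter ℝ}, Tendsto (fun z => |x - z|) l atTop →
      Tendsto (fun z => 1 / 2 * Real.exp (-|x - z|) * (s * f z - f' z)) (l ⊓ 𝓟 I) (nhds 0) := by
    intro l hl
    have hexp : Tendsto (fun z => 1 / 2 * Real.exp (-|x - z|)) (l ⊓ 𝓟 I) (nhds 0) := by
      rw [← mul_zero (1 / 2 : ℝ)]
      exact ((Real.tendsto_exp_neg_atTop_nhds_zero.comp hl).mono_left inf_le_left).const_mul _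
    refine hexp.zero_mul_isBoundedUnder_le (isBoundedUnder_of_eventually_le (a := |s| * C + C) ?_)
    refine eventually_inf_principal.2 (.of_forall fun z hz => ?_)
    calc ‖s * f z - f' z‖ ≤ |s| * |f z| + |f' z| := by
          rw [← abs_mul]; exact norm_sub_le _ _
      _ ≤ |s| * C + C := by
          gcongr
          exacts [(hC z hz).1, (hC z hz).2]
  refine setIntegral_eq_zero_of_hasDerivAt_of_tendsto hIopen hIconn
    (G := fun z => 1 / 2 * Real.exp (-|x - z|) * (s * f z - f' z)) (fun z hz => ?_) ?_
    (fun c hc => ?_) (hdecay ?_) (hdecay ?_)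
  · refine (((hasDerivAt_exp_neg_abs_sub s (hne z hz) (hsI z hz)).const_mul (1 / 2)).mul
      (((hf' z hz).const_mul s).sub (hf'' z hz))).congr_deriv ?_
    simp only [Pi.sub_apply]
    linear_combination (1 / 2) * Real.exp (-|x - z|) * f z * hs
  · refine ((hintf.sub hint).const_mul (1 / 2)).congr (.of_forall fun z => ?_)
    simp only [Pi.sub_apply]
    ring
  · have hexp : Tendsto (fun z => 1 / 2 * Real.exp (-|x - z|)) (nhdsWithin c I)
        (nhds (1 / 2 * Real.exp (-|x - c|))) :=
      (Continuous.tendsto (by fun_prop) c).mono_left nhdsWithin_le_nhds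
    simpa using hexp.mul (((hends c hc).1.const_mul s).sub (hends c hc).2)
  · exact tendsto_abs_atTop_atTop.comp (tendsto_const_nhds.add_atTop tendsto_neg_atBot_atTop)
  · exact tendsto_abs_atBot_atTop.comp (tendsto_const_nhds.add_atBot tendsto_neg_atTop_atBot)
end

section
/- Let I ⊆ ℝ be an open interval (possibly unbounded) and f : ℝ → ℝ a function that is twice continuously differentiable on I, with f and f' bounded on I, such that f(z) → 0 and f'(z) → 0 as z tends from within I to any finite endpoint of I, and such that for the given x the function z ↦ e^{−|x−z|}·f''(z) is integrable on I. Then for every x ∈ I, ∫_I (1/2)·e^{−|x−z|}·( f(z) − f''(z) ) dz = f(x). -/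
open MeasureTheory Set Filter

theorem csSup_notMem_of_isOpen {I : Set ℝ} (hIopen : IsOpen I) (hb : BddAbove I) :
    sSup I ∉ I := fun h => by
  obtain ⟨u, hu, hsub⟩ := exists_Ico_subset_of_mem_nhds (hIopen.mem_nhds h) (exists_gt _)
  obtain ⟨v, hv1, hv2⟩ := exists_between hu
  exact absurd (le_csSup hb (hsub ⟨hv1.le, hv2⟩)) hv1.not_ge

theorem inter_Ioi_eq_Ioo_csSup {I : Set ℝ} (hIopen : IsOpen I) (hIconn : I.OrdConnected)
    {x : ℝ} (hx : x ∈ I) (hb : BddAbove I) : I ∩ Ioi x = Ioo x (sSup I) := by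
  have hnot := csSup_notMem_of_isOpen hIopen hb
  ext z
  constructor
  · rintro ⟨hz, hxz⟩
    exact ⟨hxz, lt_of_le_of_ne (le_csSup hb hz) fun h => hnot (h ▸ hz)⟩
  · rintro ⟨hxz, hz⟩
    obtain ⟨w, hw, hzw⟩ := exists_lt_of_lt_csSup ⟨x, hx⟩ hz
    exact ⟨hIconn.out hx hw ⟨hxz.le, hzw.le⟩, hxz⟩

theorem inter_Ioi_eq_Ioi {I : Set ℝ} (hIconn : I.OrdConnected) {x : ℝ} (hx : x ∈ I)
    (hb : ¬BddAbove I) : I ∩ Ioi x = Ioi x := by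
  refine inter_eq_right.2 fun z hz => ?_
  obtain ⟨w, hw, hzw⟩ := not_bddAbove_iff.1 hb z
  exact hIconn.out hx hw ⟨le_of_lt hz, hzw.le⟩

/-- The part of the Helmholtz kernel integral lying to the right of the evaluation point. -/
theorem helmholtz_kernel_parts_right {I : Set ℝ} (hIopen : IsOpen I)
    (hIconn : I.OrdConnected) {f f' f'' : ℝ → ℝ}
    (hf' : ∀ z ∈ I, HasDerivAt f (f' z) z)
    (hf'' : ∀ z ∈ I, HasDerivAt f' (f'' z) z)
    (hbdd : ∃ C : ℝ, ∀ z ∈ I, |f z| ≤ C ∧ |f' z| ≤ C)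
    (hends : ∀ c ∈ frontier I,
      Tendsto f (nhdsWithin c I) (nhds 0) ∧ Tendsto f' (nhdsWithin c I) (nhds 0))
    {x : ℝ} (hx : x ∈ I)
    (hint : IntegrableOn (fun z => Real.exp (-|x - z|) * f'' z) I) :
    IntegrableOn (fun z => Real.exp (-|x - z|) * (f z - f'' z)) (I ∩ Ioi x) ∧
      ∫ z in I ∩ Ioi x, Real.exp (-|x - z|) * (f z - f'' z) = f x + f' x := by
  obtain ⟨C, hC⟩ := hbdd
  have hmeas : MeasurableSet (I ∩ Ioi x) := hIopen.measurableSet.inter measurableSet_Ioi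
  have hker : ∀ z ∈ I ∩ Ioi x, Real.exp (-|x - z|) = Real.exp (x - z) := fun z hz => by
    rw [abs_of_neg (sub_neg.2 hz.2), neg_neg]
  have hexp : IntegrableOn (fun z => Real.exp (x - z)) (I ∩ Ioi x) := by
    have h := (integrableOn_exp_neg_Ioi x).const_mul (Real.exp x)
    simp only [← Real.exp_add, ← sub_eq_add_neg] at h
    exact IntegrableOn.mono_set h inter_subset_right
  have hcont : ContinuousOn f I := fun z hz => (hf' z hz).continuousAt.continuousWithinAt
  have hfint : IntegrableOn (fun z => Real.exp (x - z) * f z) (I ∩ Ioi x) := by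
    refine Integrable.mul_bdd (c := C) hexp
      ((hcont.mono inter_subset_left).aestronglyMeasurable hmeas) ?_
    exact (ae_restrict_iff' hmeas).2 (.of_forall fun z hz => (hC z hz.1).1)
  have hint' : IntegrableOn (fun z => Real.exp (x - z) * (f z - f'' z)) (I ∩ Ioi x) := by
    have h : IntegrableOn (fun z => Real.exp (x - z) * f'' z) (I ∩ Ioi x) :=
      (hint.mono_set inter_subset_left).congr_fun (fun z hz => by simp only [hker z hz]) hmeas
    simp only [mul_sub]
    exact Integrable.sub hfint h
  have hcongr : EqOn (fun z => Real.exp (x - z) * (f z - f'' z))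
      (fun z => Real.exp (-|x - z|) * (f z - f'' z)) (I ∩ Ioi x) :=
    fun z hz => by simp only [hker z hz]
  refine ⟨hint'.congr_fun hcongr hmeas, ?_⟩
  rw [← setIntegral_congr_fun hmeas hcongr]
  have hderiv : ∀ z ∈ I, HasDerivAt (fun z => -(Real.exp (x - z) * (f z + f' z)))
      (Real.exp (x - z) * (f z - f'' z)) z := fun z hz => by
    refine (((((hasDerivAt_id z).const_sub x).exp).mul
      ((hf' z hz).add (hf'' z hz))).neg).congr_deriv ?_
    simp only [id_eq, Pi.add_apply]
    ring
  by_cases hb : BddAbove I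
  · have hI := inter_Ioi_eq_Ioo_csSup hIopen hIconn hx hb
    have hsub : Ioo x (sSup I) ⊆ I := hI ▸ inter_subset_left
    have hnot := csSup_notMem_of_isOpen hIopen hb
    have hxb : x < sSup I := lt_of_le_of_ne (le_csSup hb hx) fun h => hnot (h ▸ hx)
    have hfr : sSup I ∈ frontier I :=
      ⟨csSup_mem_closure ⟨x, hx⟩ hb, fun h => hnot (interior_subset h)⟩
    have hle : nhdsWithin (sSup I) (Iio (sSup I)) ≤ nhdsWithin (sSup I) I := by
      rw [← nhdsWithin_Ioo_eq_nhdsLT hxb]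
      exact nhdsWithin_mono _ hsub
    have hlim : Tendsto (fun z => -(Real.exp (x - z) * (f z + f' z)))
        (nhdsWithin (sSup I) (Iio (sSup I))) (nhds 0) := by
      have he : Tendsto (fun z => Real.exp (x - z)) (nhdsWithin (sSup I) (Iio (sSup I)))
          (nhds (Real.exp (x - sSup I))) :=
        (Continuous.tendsto (by fun_prop) _).mono_left nhdsWithin_le_nhds
      simpa using (he.mul (((hends _ hfr).1.mono_left hle).add
        ((hends _ hfr).2.mono_left hle))).neg
    rw [hI] at hint' ⊢
    rw [← integral_Ioc_eq_integral_Ioo, ← intervalIntegral.integral_of_le hxb.le,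
      intervalIntegral.integral_eq_sub_of_hasDerivAt_of_tendsto hxb
        (fun z hz => hderiv z (hsub hz))
        ((intervalIntegrable_iff_integrableOn_Ioo_of_le hxb.le).2 hint')
        ((hderiv x hx).continuousAt.tendsto.mono_left nhdsWithin_le_nhds) hlim]
    simp
  · have hI := inter_Ioi_eq_Ioi hIconn hx hb
    have hsub : Ioi x ⊆ I := inter_eq_right.1 hI
    rw [hI] at hint' ⊢
    have he : Tendsto (fun z => Real.exp (x - z)) atTop (nhds 0) :=
      Real.tendsto_exp_atBot.comp (tendsto_atBot_add_const_left _ x tendsto_neg_atTop_atBot)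
    have hlim : Tendsto (fun z => -(Real.exp (x - z) * (f z + f' z))) atTop (nhds 0) := by
      have hbd : IsBoundedUnder (· ≤ ·) atTop ((‖·‖) ∘ fun z => f z + f' z) := by
        refine isBoundedUnder_of_eventually_le (a := C + C) ?_
        filter_upwards [eventually_gt_atTop x] with z hz
        exact (abs_add_le _ _).trans (add_le_add (hC z (hsub hz)).1 (hC z (hsub hz)).2)
      simpa using (he.zero_mul_isBoundedUnder_le hbd).neg
    rw [integral_Ioi_of_hasDerivAt_of_tendsto (hderiv x hx).continuousAt.continuousWithinAt
      (fun z hz => hderiv z (hsub hz)) hint' hlim]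
    simp

/-- The part of the Helmholtz kernel integral lying to the left of the evaluation point. -/
theorem helmholtz_kernel_parts_left {I : Set ℝ} (hIopen : IsOpen I)
    (hIconn : I.OrdConnected) {f f' f'' : ℝ → ℝ}
    (hf' : ∀ z ∈ I, HasDerivAt f (f' z) z)
    (hf'' : ∀ z ∈ I, HasDerivAt f' (f'' z) z)
    (hbdd : ∃ C : ℝ, ∀ z ∈ I, |f z| ≤ C ∧ |f' z| ≤ C)
    (hends : ∀ c ∈ frontier I,
      Tendsto f (nhdsWithin c I) (nhds 0) ∧ Tendsto f' (nhdsWithin c I) (nhds 0))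
    {x : ℝ} (hx : x ∈ I)
    (hint : IntegrableOn (fun z => Real.exp (-|x - z|) * f'' z) I) :
    IntegrableOn (fun z => Real.exp (-|x - z|) * (f z - f'' z)) (I ∩ Iio x) ∧
      ∫ z in I ∩ Iio x, Real.exp (-|x - z|) * (f z - f'' z) = f x - f' x := by
  have hmp : MeasurePreserving (Neg.neg : ℝ → ℝ) := Measure.measurePreserving_neg volume
  have hemb : MeasurableEmbedding (Neg.neg : ℝ → ℝ) := (Homeomorph.neg ℝ).measurableEmbedding
  have habs : ∀ z, |-x - z| = |x - -z| := fun z => by rw [← abs_neg]; congr 1; ring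
  have hset : Neg.neg ⁻¹' I ∩ Ioi (-x) = Neg.neg ⁻¹' (I ∩ Iio x) := by
    ext z
    simp
  obtain ⟨C, hC⟩ := hbdd
  have key := helmholtz_kernel_parts_right (I := Neg.neg ⁻¹' I) (f := fun z => f (-z))
    (f' := fun z => -f' (-z)) (f'' := fun z => f'' (-z)) (x := -x)
    (hIopen.preimage continuous_neg)
    ⟨fun a ha b hb z hz => hIconn.out hb ha ⟨neg_le_neg hz.2, neg_le_neg hz.1⟩⟩
    (fun z hz => ((hf' (-z) hz).comp z (hasDerivAt_neg z)).congr_deriv (by simp))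
    (fun z hz => ((hf'' (-z) hz).comp z (hasDerivAt_neg z)).neg.congr_deriv (by simp))
    ⟨C, fun z hz => by simpa using hC (-z) hz⟩
    (fun c hc => by
      have hc' : -c ∈ frontier I := by
        have h := (Homeomorph.neg ℝ).preimage_frontier I
        exact (Set.ext_iff.1 h c).2 hc
      have ht : Tendsto (Neg.neg : ℝ → ℝ) (nhdsWithin c (Neg.neg ⁻¹' I)) (nhdsWithin (-c) I) :=
        continuous_neg.continuousWithinAt.tendsto_nhdsWithin fun z hz => hz
      refine ⟨(hends _ hc').1.comp ht, ?_⟩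
      simpa using ((hends _ hc').2.comp ht).neg)
    (by simpa using hx)
    (by
      simp only [habs]
      exact (hmp.integrableOn_comp_preimage hemb).2 hint)
  simp only [habs, hset, neg_neg, ← sub_eq_add_neg] at key
  refine ⟨(hmp.integrableOn_comp_preimage hemb).1 key.1, ?_⟩
  rw [← key.2]
  exact (hmp.setIntegral_preimage_emb hemb
    (fun z => Real.exp (-|x - z|) * (f z - f'' z)) (I ∩ Iio x)).symm



/-- Integration-by-parts lemma for the Helmholtz kernel `½e^{−|x−z|}` on a single open
interval `I` of smoothness, in the case where the evaluation point `x` lies inside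
`I`: if `f` is `C²` on `I` with `f`, `f'` bounded on `I` and vanishing at the finite
endpoints of `I`, and `z ↦ e^{−|x−z|} f''(z)` is integrable on `I`, then
`∫_I ½e^{−|x−z|}(f(z) − f''(z)) dz = f(x)`. -/
theorem helmholtz_kernel_parts_inside (I : Set ℝ) (hIopen : IsOpen I)
    (hIconn : I.OrdConnected) (f f' f'' : ℝ → ℝ)
    (hf' : ∀ z ∈ I, HasDerivAt f (f' z) z)
    (hf'' : ∀ z ∈ I, HasDerivAt f' (f'' z) z)
    (hf''cont : ContinuousOn f'' I)
    (hbdd : ∃ C : ℝ, ∀ z ∈ I, |f z| ≤ C ∧ |f' z| ≤ C)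
    (hends : ∀ c ∈ frontier I,
      Tendsto f (nhdsWithin c I) (nhds 0) ∧ Tendsto f' (nhdsWithin c I) (nhds 0))
    (x : ℝ) (hx : x ∈ I)
    (hint : IntegrableOn (fun z => Real.exp (-|x - z|) * f'' z) I) :
    ∫ z in I, (1 / 2) * Real.exp (-|x - z|) * (f z - f'' z) = f x := by
  obtain ⟨hri, hr⟩ := helmholtz_kernel_parts_right hIopen hIconn hf' hf'' hbdd hends hx hint
  obtain ⟨hli, hl⟩ := helmholtz_kernel_parts_left hIopen hIconn hf' hf'' hbdd hends hx hint
  have hunion : (I ∩ Iio x ∪ I ∩ Ioi x : Set ℝ) =ᵐ[volume] I := by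
    rw [← inter_union_distrib_left, Iio_union_Ioi, ← sdiff_eq]
    exact sdiff_null_ae_eq_self (measure_singleton x)
  have hdisj : Disjoint (I ∩ Iio x) (I ∩ Ioi x) :=
    (Iio_disjoint_Ioi_same (a := x)).mono inter_subset_right inter_subset_right
  simp only [mul_assoc]
  rw [integral_const_mul, ← setIntegral_congr_set hunion,
    setIntegral_union hdisj (hIopen.measurableSet.inter measurableSet_Ioi) hli hri, hl, hr]
  ring
end

section
/- For all s ∈ ℝ and x ∈ ℝ, ∫_ℝ (1/2)·e^{−|x−z|}·( s²·e^{−2|z|} + (1/2)·s²·e^{−2|z|} ) dz = (1/2)·s²·( 1 − (1 − e^{−|x|})² ). -/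
open MeasureTheory Real

/-- The convolution of `e^{-|z|}` with `e^{-2|z|}` at a nonnegative point. -/
lemma integral_exp_neg_abs_sub_mul_of_nonneg {x : ℝ} (hx : 0 ≤ x) :
    ∫ z : ℝ, Real.exp (-|x - z|) * Real.exp (-2 * |z|)
      = (2 / 3) * (1 - (1 - Real.exp (-x)) ^ 2) := by
  have left : Set.EqOn (fun z : ℝ => Real.exp (-|x - z|) * Real.exp (-2 * |z|))
      (fun z => Real.exp (-x) * Real.exp (3 * z)) (Set.Iic 0) := by
    intro z (hz : z ≤ 0)
    simp only
    rw [abs_of_nonneg (by linarith : 0 ≤ x - z), abs_of_nonpos hz, ← Real.exp_add, ← Real.exp_add]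
    ring_nf
  have middle : Set.EqOn (fun z : ℝ => Real.exp (-|x - z|) * Real.exp (-2 * |z|))
      (fun z => Real.exp (-x) * Real.exp (-z)) (Set.Ioc 0 x) := by
    rintro z ⟨hz, hzx⟩
    simp only
    rw [abs_of_nonneg (by linarith : 0 ≤ x - z), abs_of_pos hz, ← Real.exp_add, ← Real.exp_add]
    ring_nf
  have right : Set.EqOn (fun z : ℝ => Real.exp (-|x - z|) * Real.exp (-2 * |z|))
      (fun z => Real.exp x * Real.exp (-3 * z)) (Set.Ioi x) := by
    intro z (hz : x < z)
    simp only
    rw [abs_of_neg (by linarith : x - z < 0), abs_of_pos (hx.trans_lt hz), ← Real.exp_add,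
      ← Real.exp_add]
    ring_nf
  have int_left := (integrableOn_congr_fun left measurableSet_Iic).2
    ((integrableOn_exp_mul_Iic (by norm_num : (0 : ℝ) < 3) 0).const_mul (Real.exp (-x)))
  have int_middle : IntegrableOn
      (fun z : ℝ => Real.exp (-|x - z|) * Real.exp (-2 * |z|)) (Set.Ioc 0 x) :=
    Continuous.integrableOn_Ioc (by fun_prop)
  have int_right := (integrableOn_congr_fun right measurableSet_Ioi).2
    ((integrableOn_exp_mul_Ioi (by norm_num : (-3 : ℝ) < 0) x).const_mul (Real.exp x))
  have int_Ioi : IntegrableOn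
      (fun z : ℝ => Real.exp (-|x - z|) * Real.exp (-2 * |z|)) (Set.Ioi 0) := by
    rw [← Set.Ioc_union_Ioi_eq_Ioi hx]
    exact int_middle.union int_right
  rw [← intervalIntegral.integral_Iic_add_Ioi int_left int_Ioi, ← Set.Ioc_union_Ioi_eq_Ioi hx,
    setIntegral_union (Set.Ioc_disjoint_Ioi le_rfl) measurableSet_Ioi int_middle int_right,
    setIntegral_congr_fun measurableSet_Iic left, setIntegral_congr_fun measurableSet_Ioc middle,
    setIntegral_congr_fun measurableSet_Ioi right, integral_const_mul, integral_const_mul,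
    integral_const_mul, integral_exp_mul_Iic (by norm_num), integral_exp_mul_Ioi (by norm_num),
    ← intervalIntegral.integral_of_le hx, intervalIntegral.integral_comp_neg Real.exp,
    integral_exp]
  have h₁ : Real.exp x * Real.exp (-3 * x) = Real.exp (-x) ^ 2 := by
    rw [← Real.exp_add, ← Real.exp_nat_mul]
    ring_nf
  simp only [mul_zero, neg_zero, Real.exp_zero]
  linear_combination (1 / 3) * h₁

/-- The convolution of `e^{-|z|}` with `e^{-2|z|}`. -/
lemma integral_exp_neg_abs_sub_mul (x : ℝ) :
    ∫ z : ℝ, Real.exp (-|x - z|) * Real.exp (-2 * |z|)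
      = (2 / 3) * (1 - (1 - Real.exp (-|x|)) ^ 2) := by
  rcases le_total 0 x with hx | hx
  · rw [abs_of_nonneg hx, integral_exp_neg_abs_sub_mul_of_nonneg hx]
  · rw [abs_of_nonpos hx, ← integral_exp_neg_abs_sub_mul_of_nonneg (neg_nonneg.2 hx),
      ← integral_neg_eq_self]
    congr 1 with z
    rw [abs_neg, ← abs_neg (x - -z)]
    ring_nf

/-- The nonlocal term `P(0,x)` for the decaying peakon `φ(z) = s·e^{−|z|}` of the
Camassa–Holm equation equals `(1/2)s²(1 − (1 − e^{−|x|})²)`. -/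
theorem peakon_P_formula (s x : ℝ) :
    ∫ z : ℝ, (1 / 2) * Real.exp (-|x - z|) *
        (s ^ 2 * Real.exp (-2 * |z|) + (1 / 2) * s ^ 2 * Real.exp (-2 * |z|))
      = (1 / 2) * s ^ 2 * (1 - (1 - Real.exp (-|x|)) ^ 2) := by
  calc
    _ = ∫ z : ℝ, (3 / 4) * s ^ 2 * (Real.exp (-|x - z|) * Real.exp (-2 * |z|)) := by
      congr 1 with z
      ring
    _ = _ := by
      rw [integral_const_mul, integral_exp_neg_abs_sub_mul]
      ring
end

section
/- Let s ∈ ℝ and w₀ ∈ ℝ with w₀ ≠ 0, and set σ = sign(w₀) ∈ {−1, +1}. Define w : ℝ → ℝ by w(t) = σ·ln( 1 + (e^{|w₀|} − 1)·e^{−σ·s·t} ). Then w is differentiable on ℝ, w(0) = w₀, σ·w(t) > 0 for all t, and w'(t) = s·( e^{−|w(t)|} − 1 ) for all t ∈ ℝ. -/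
/-- The explicit shifted characteristic
`w(t) = sign(w₀)·ln(1 + (e^{|w₀|} − 1)e^{−sign(w₀)·s·t})` of the decaying peakon of the
Camassa–Holm equation is differentiable, starts at `w₀`, keeps the sign of `w₀`, and
solves the ODE `w' = s(e^{−|w|} − 1)`. -/
theorem peakon_characteristic_ode (s w₀ : ℝ) (hw₀ : w₀ ≠ 0) (σ : ℝ)
    (hσ : σ = Real.sign w₀) (w : ℝ → ℝ)
    (hw : ∀ t, w t = σ * Real.log (1 + (Real.exp |w₀| - 1) * Real.exp (-σ * s * t))) :
    (σ = -1 ∨ σ = 1) ∧ Differentiable ℝ w ∧ w 0 = w₀ ∧ (∀ t, σ * w t > 0) ∧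
      ∀ t, HasDerivAt w (s * (Real.exp (-|w t|) - 1)) t := by
  have hσ1 : σ = -1 ∨ σ = 1 := hσ ▸ Real.sign_apply_eq_of_ne_zero w₀ hw₀
  have hσσ : σ * σ = 1 := by rcases hσ1 with h | h <;> simp [h]
  have hσabs : |σ| = 1 := by rcases hσ1 with h | h <;> simp [h]
  have hc : 0 < Real.exp |w₀| - 1 :=
    sub_pos.mpr (Real.one_lt_exp_iff.mpr (abs_pos.mpr hw₀))
  have hE : ∀ t, 0 < (Real.exp |w₀| - 1) * Real.exp (-σ * s * t) := fun t =>
    mul_pos hc (Real.exp_pos _)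
  have hlog : ∀ t, 0 < Real.log (1 + (Real.exp |w₀| - 1) * Real.exp (-σ * s * t)) := fun t =>
    Real.log_pos (by linarith [hE t])
  have hderiv : ∀ t, HasDerivAt w (s * (Real.exp (-|w t|) - 1)) t := by
    intro t
    have hne : 1 + (Real.exp |w₀| - 1) * Real.exp (-σ * s * t) ≠ 0 := by linarith [hE t]
    have hexp : HasDerivAt (fun t => Real.exp (-σ * s * t))
        (Real.exp (-σ * s * t) * (-σ * s)) t := by
      simpa using ((hasDerivAt_id t).const_mul (-σ * s)).exp
    have h := (((hexp.const_mul (Real.exp |w₀| - 1)).const_add 1).log hne).const_mul σ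
    rw [← funext hw] at h
    refine h.congr_deriv ?_
    rw [hw, abs_mul, hσabs, one_mul, abs_of_pos (hlog t), Real.exp_neg,
      Real.exp_log (by linarith [hE t])]
    field_simp
    linear_combination (-s * (Real.exp |w₀| - 1) * Real.exp (-(σ * s * t))) * hσσ
  refine ⟨hσ1, fun t => (hderiv t).differentiableAt, ?_, fun t => ?_, hderiv⟩
  · rw [hw, mul_zero, Real.exp_zero, mul_one, add_sub_cancel, Real.log_exp, hσ]
    rcases hw₀.lt_or_gt with h | h
    · simp [Real.sign_of_neg h, abs_of_neg h]
    · simp [Real.sign_of_pos h, abs_of_pos h]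
  · rw [hw, ← mul_assoc, hσσ, one_mul]
    exact hlog t
end

section
/- Let s ∈ ℝ, L > 0, and w₀ ∈ ℝ with |w₀| < L. Define w : ℝ → ℝ by w(t) = −2·artanh( tanh(L/2) · tanh( (s·t/2)·tanh(L) − artanh( tanh(w₀/2) / tanh(L/2) ) ) ). Then w is differentiable on ℝ, w(0) = w₀, |w(t)| < L for all t, and w'(t) = s·( cosh(w(t))/cosh(L) − 1 ) for all t ∈ ℝ. -/
/-- The inverse hyperbolic tangent. -/
noncomputable def artanh (x : ℝ) : ℝ := Real.log ((1 + x) / (1 - x)) / 2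

theorem artanh_eq_real_artanh {x : ℝ} (hx : x ∈ Set.Ioo (-1) 1) : artanh x = Real.artanh x := by
  rw [artanh, Real.artanh_eq_half_log (Set.Ioo_subset_Icc_self hx)]
  ring

theorem tanh_mem_Ioo (x : ℝ) : Real.tanh x ∈ Set.Ioo (-1) 1 :=
  ⟨Real.neg_one_lt_tanh x, Real.tanh_lt_one x⟩

theorem artanh_tanh (x : ℝ) : artanh (Real.tanh x) = x := by
  rw [artanh_eq_real_artanh (tanh_mem_Ioo x), Real.artanh_tanh]

theorem tanh_artanh {x : ℝ} (hx : x ∈ Set.Ioo (-1) 1) : Real.tanh (artanh x) = x := by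
  rw [artanh_eq_real_artanh hx, Real.tanh_artanh hx]

theorem artanh_neg (x : ℝ) : artanh (-x) = -artanh x := by
  rw [artanh, artanh, ← neg_div, ← Real.log_inv, inv_div, sub_neg_eq_add, ← sub_eq_add_neg]

theorem artanh_lt_artanh {x y : ℝ} (hx : -1 < x) (hy : y < 1) (hxy : x < y) :
    artanh x < artanh y := by
  rw [artanh_eq_real_artanh ⟨hx, hxy.trans hy⟩, artanh_eq_real_artanh ⟨hx.trans hxy, hy⟩]
  exact Real.artanh_lt_artanh hx hy hxy

theorem hasDerivAt_tanh (x : ℝ) : HasDerivAt Real.tanh (1 - Real.tanh x ^ 2) x := by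
  have hc := (Real.cosh_pos x).ne'
  rw [show Real.tanh = fun y => Real.sinh y / Real.cosh y from
    funext Real.tanh_eq_sinh_div_cosh]
  refine ((Real.hasDerivAt_sinh x).fun_div (Real.hasDerivAt_cosh x) hc).congr_deriv ?_
  field_simp

theorem hasDerivAt_artanh {x : ℝ} (hx : x ∈ Set.Ioo (-1) 1) :
    HasDerivAt artanh (1 / (1 - x ^ 2)) x := by
  have h₁ : 0 < 1 + x := by linarith [hx.1]
  have h₂ : 0 < 1 - x := by linarith [hx.2]
  have h₃ : 1 - x ^ 2 ≠ 0 := by nlinarith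
  have h := ((((hasDerivAt_id x).const_add 1).fun_div ((hasDerivAt_id x).const_sub 1)
    h₂.ne').log (div_pos h₁ h₂).ne').div_const 2
  refine h.congr_deriv ?_
  simp only [id]
  field_simp
  ring

theorem tanh_strictMono : StrictMono Real.tanh :=
  strictMono_of_deriv_pos fun x => by
    rw [(hasDerivAt_tanh x).deriv]
    linarith [Real.tanh_sq_lt_one x]

theorem cosh_eq_tanh_half (x : ℝ) :
    Real.cosh x = (1 + Real.tanh (x / 2) ^ 2) / (1 - Real.tanh (x / 2) ^ 2) := by
  have hc := (Real.cosh_pos (x / 2)).ne'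
  have hs := Real.cosh_sq_sub_sinh_sq (x / 2)
  have h := Real.cosh_two_mul (x / 2)
  rw [mul_div_cancel₀ x two_ne_zero] at h
  rw [h, Real.tanh_eq_sinh_div_cosh, div_pow]
  have hc2 := pow_ne_zero 2 hc
  rw [one_add_div hc2, one_sub_div hc2, hs]
  field_simp

theorem tanh_eq_tanh_half (x : ℝ) :
    Real.tanh x = 2 * Real.tanh (x / 2) / (1 + Real.tanh (x / 2) ^ 2) := by
  have hc := Real.cosh_pos (x / 2)
  have h := Real.sinh_two_mul (x / 2)
  have h' := Real.cosh_two_mul (x / 2)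
  rw [mul_div_cancel₀ x two_ne_zero] at h h'
  rw [Real.tanh_eq_sinh_div_cosh, h, h', Real.tanh_eq_sinh_div_cosh]
  have : Real.cosh (x / 2) ^ 2 + Real.sinh (x / 2) ^ 2 ≠ 0 := by positivity
  field_simp

/-- The explicit shifted characteristic of the periodic peakon of the Camassa–Holm
equation: `w(t) = −2 artanh(tanh(L/2) tanh((st/2)tanh L − artanh(tanh(w₀/2)/tanh(L/2))))`
is differentiable, starts at `w₀`, stays in `(−L, L)`, and solves the ODE
`w' = s(cosh(w)/cosh(L) − 1)`. -/
theorem periodic_peakon_characteristic_ode (s L w₀ : ℝ) (hL : 0 < L) (hw₀ : |w₀| < L)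
    (w : ℝ → ℝ)
    (hw : ∀ t, w t = -2 * artanh (Real.tanh (L / 2) *
      Real.tanh (s * t / 2 * Real.tanh L - artanh (Real.tanh (w₀ / 2) / Real.tanh (L / 2))))) :
    Differentiable ℝ w ∧ w 0 = w₀ ∧ (∀ t, |w t| < L) ∧
      ∀ t, HasDerivAt w (s * (Real.cosh (w t) / Real.cosh L - 1)) t := by
  obtain ⟨hw₀l, hw₀u⟩ := abs_lt.mp hw₀
  have hT : 0 < Real.tanh (L / 2) := by
    simpa using tanh_strictMono (half_pos hL)
  have hT1 := Real.tanh_lt_one (L / 2)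
  have hquot : Real.tanh (w₀ / 2) / Real.tanh (L / 2) ∈ Set.Ioo (-1) 1 := by
    constructor
    · rw [lt_div_iff₀ hT, neg_one_mul, ← Real.tanh_neg]
      exact tanh_strictMono (by linarith)
    · rw [div_lt_one hT]
      exact tanh_strictMono (by linarith)
  have hder : ∀ t, HasDerivAt w (s * (Real.cosh (w t) / Real.cosh L - 1)) t := by
    intro t
    set a := artanh (Real.tanh (w₀ / 2) / Real.tanh (L / 2))
    have hφ : HasDerivAt (fun t => s * t / 2 * Real.tanh L - a) (s / 2 * Real.tanh L) t := by
      simpa using ((((hasDerivAt_id t).const_mul s).div_const 2).mul_const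
        (Real.tanh L)).sub_const a
    set r := Real.tanh (s * t / 2 * Real.tanh L - a) with hr
    obtain ⟨hr₁, hr₂⟩ := tanh_mem_Ioo (s * t / 2 * Real.tanh L - a)
    rw [← hr] at hr₁ hr₂
    have hx : Real.tanh (L / 2) * r ∈ Set.Ioo (-1) 1 := by
      constructor <;> nlinarith
    have h := ((hasDerivAt_artanh hx).comp t
      (((hasDerivAt_tanh _).comp t hφ).const_mul (Real.tanh (L / 2)))).const_mul (-2)
    have hwt : Real.tanh (w t / 2) = -(Real.tanh (L / 2) * r) := by
      rw [hw t, ← hr, show -2 * artanh (Real.tanh (L / 2) * r) / 2 =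
        -artanh (Real.tanh (L / 2) * r) by ring, Real.tanh_neg, tanh_artanh hx]
    have hfun : w = fun t => -2 * artanh (Real.tanh (L / 2) *
        Real.tanh (s * t / 2 * Real.tanh L - a)) := funext hw
    rw [cosh_eq_tanh_half (w t), hwt, cosh_eq_tanh_half L]
    rw [hfun]
    refine h.congr_deriv ?_
    rw [← hr, tanh_eq_tanh_half L]
    have h₁ : 1 - Real.tanh (L / 2) ^ 2 * r ^ 2 ≠ 0 := by nlinarith [hx.1, hx.2]
    have h₂ : 1 - Real.tanh (L / 2) ^ 2 ≠ 0 := by nlinarith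
    have h₃ : 1 + Real.tanh (L / 2) ^ 2 ≠ 0 := by positivity
    generalize Real.tanh (L / 2) = T at *
    rw [neg_sq, mul_pow]
    field_simp
    ring
  refine ⟨fun t => (hder t).differentiableAt, ?_, fun t => ?_, hder⟩
  · rw [hw, mul_zero, zero_div, zero_mul, zero_sub, Real.tanh_neg, tanh_artanh hquot, mul_neg,
      mul_div_cancel₀ _ hT.ne', artanh_neg, artanh_tanh]
    ring
  · rw [hw]
    obtain ⟨hr₁, hr₂⟩ := tanh_mem_Ioo
      (s * t / 2 * Real.tanh L - artanh (Real.tanh (w₀ / 2) / Real.tanh (L / 2)))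
    generalize Real.tanh (s * t / 2 * Real.tanh L - _) = r at *
    have hu : artanh (Real.tanh (L / 2) * r) < L / 2 := by
      conv_rhs => rw [← artanh_tanh (L / 2)]
      exact artanh_lt_artanh (by nlinarith) hT1 (by nlinarith)
    have hl : -(L / 2) < artanh (Real.tanh (L / 2) * r) := by
      conv_lhs => rw [← artanh_tanh (L / 2), ← artanh_neg]
      exact artanh_lt_artanh (by linarith) (by nlinarith) (by nlinarith)
    rw [abs_lt]
    constructor <;> linarith
end

section
/- Let M, m, s, z ∈ ℝ with z < m < s < M and L > 0. Let φ : [0, L] → ℝ be continuous with φ(0) = s, φ(L) = m, continuously differentiable on (0, L) with φ'(x) < 0 and m < φ(x) < s there, and satisfying (s − φ(x))·φ'(x)² = (M − φ(x))·(φ(x) − m)·(φ(x) − z) for all x ∈ (0, L). Then the improper integral ∫_m^s √(s − y) / ( √(M − y)·√(y − m)·√(y − z) ) dy converges and equals L. -/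
open MeasureTheory Set

/-- Separation of variables: if `a v² = b c d` with all of `a, b, c, d` positive, then the
integrand `√a / (√b √c √d)` is the reciprocal of `|v|`. -/
theorem abs_mul_sqrt_div_eq_one {a b c d v : ℝ} (ha : 0 < a) (hb : 0 < b) (hc : 0 < c)
    (hd : 0 < d) (h : a * v ^ 2 = b * c * d) :
    |v| * (Real.sqrt a / (Real.sqrt b * Real.sqrt c * Real.sqrt d)) = 1 := by
  have key : Real.sqrt a * |v| = Real.sqrt b * Real.sqrt c * Real.sqrt d := by
    rw [← Real.sqrt_sq_eq_abs, ← Real.sqrt_mul ha.le, h, Real.sqrt_mul (by positivity),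
      Real.sqrt_mul hb.le]
  rw [← mul_div_assoc, mul_comm, key]
  exact div_self (by positivity)

/-- The half-period of a periodic cuspon of the Camassa–Holm equation as an integral
over the range of the profile: if `φ` decreases from its cusp value `s` at `x = 0` to
its trough value `m` at `x = L` and satisfies the traveling-wave ODE
`(s − φ)(φ')² = (M − φ)(φ − m)(φ − z)` on `(0, L)`, then
`∫_m^s √(s−y)/(√(M−y)√(y−m)√(y−z)) dy` converges and equals `L`. -/
theorem cuspon_halfperiod_integral (M m s z L : ℝ) (hzm : z < m) (hms : m < s)
    (hsM : s < M) (hL : 0 < L) (φ φ' : ℝ → ℝ)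
    (hcont : ContinuousOn φ (Icc 0 L)) (h0 : φ 0 = s) (hLm : φ L = m)
    (hdiff : ∀ x ∈ Ioo (0 : ℝ) L, HasDerivAt φ (φ' x) x)
    (hφ'cont : ContinuousOn φ' (Ioo 0 L))
    (hneg : ∀ x ∈ Ioo (0 : ℝ) L, φ' x < 0)
    (hrange : ∀ x ∈ Ioo (0 : ℝ) L, m < φ x ∧ φ x < s)
    (hode : ∀ x ∈ Ioo (0 : ℝ) L,
      (s - φ x) * (φ' x) ^ 2 = (M - φ x) * (φ x - m) * (φ x - z)) :
    IntegrableOn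
        (fun y => Real.sqrt (s - y) /
          (Real.sqrt (M - y) * Real.sqrt (y - m) * Real.sqrt (y - z)))
        (Ioo m s) ∧
      ∫ y in Ioo m s,
        Real.sqrt (s - y) /
          (Real.sqrt (M - y) * Real.sqrt (y - m) * Real.sqrt (y - z)) = L := by
  have himage : φ '' Ioo 0 L = Ioo m s := by
    apply Subset.antisymm
    · rintro _ ⟨x, hx, rfl⟩
      exact hrange x hx
    · simpa only [h0, hLm] using intermediate_value_Ioo' hL.le hcont
  have hanti : StrictAntiOn φ (Icc 0 L) := by
    refine strictAntiOn_of_deriv_neg (convex_Icc 0 L) hcont fun x hx => ?_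
    rw [interior_Icc] at hx
    rw [(hdiff x hx).deriv]
    exact hneg x hx
  have hinj : InjOn φ (Ioo 0 L) := hanti.injOn.mono Ioo_subset_Icc_self
  have hderiv : ∀ x ∈ Ioo 0 L, HasDerivWithinAt φ (φ' x) (Ioo 0 L) x :=
    fun x hx => (hdiff x hx).hasDerivWithinAt
  have hone : ∀ x ∈ Ioo 0 L, |φ' x| • (Real.sqrt (s - φ x) /
      (Real.sqrt (M - φ x) * Real.sqrt (φ x - m) * Real.sqrt (φ x - z))) = 1 := by
    intro x hx
    obtain ⟨h1, h2⟩ := hrange x hx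
    exact abs_mul_sqrt_div_eq_one (by linarith) (by linarith) (by linarith) (by linarith)
      (hode x hx)
  rw [← himage]
  constructor
  · rw [integrableOn_image_iff_integrableOn_abs_deriv_smul measurableSet_Ioo hderiv hinj,
      integrableOn_congr_fun hone measurableSet_Ioo]
    exact integrableOn_const measure_Ioo_lt_top.ne
  · rw [integral_image_eq_integral_abs_deriv_smul measurableSet_Ioo hderiv hinj,
      setIntegral_congr_fun measurableSet_Ioo hone]
    simp [hL.le]
end
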